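/- arXiv:2408.09352 — 4 statements merged into one kernel-verified Lean document; each statement's English description precedes it below -/
import Mathlib

section
/- Let Σ, Γ, Φ be finite nonempty alphabets, μ a probability distribution on Σ×Γ×Φ with no ℤ-embeddings, 𝒜 a finite abelian group, and t : Σ×Γ×Φ → 𝒜 a target map. Assume the game has value less than 1, i.e., there exist no maps f : Σ → 𝒜, g : Γ → 𝒜, h : Φ → 𝒜 with f(x)+g(y)+h(z) = t(x,y,z) for all (x,y,z) ∈ supp(μ). Then there is a constant c > 0 such that for every n ≥ 1 and all strategies f : Σ^n → 𝒜^n, g : Γ^n → 𝒜^n, h : Φ^n → 𝒜^n, the winning probability Pr_{(x,y,z)∼μ^{⊗n}}[f(x)_i + g(y)_i + h(z)_i = t(x_i,y_i,z_i) for all i = 1,…,n] is at most 2^{-c·n}. -/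
open Finset

attribute [local instance] Classical.propDecidable

noncomputable def ind (p : Prop) : ℝ := if p then 1 else 0

lemma ind_nonneg (p : Prop) : 0 ≤ ind p := by unfold ind; split_ifs <;> norm_num
lemma ind_le_one (p : Prop) : ind p ≤ 1 := by unfold ind; split_ifs <;> norm_num
lemma ind_true {p : Prop} (h : p) : ind p = 1 := by simp [ind, h]
lemma ind_false {p : Prop} (h : ¬ p) : ind p = 0 := by simp [ind, h]
lemma ind_mono {p q : Prop} (h : p → q) : ind p ≤ ind q := by
  by_cases hp : p
  · rw [ind_true hp, ind_true (h hp)]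
  · rw [ind_false hp]; exact ind_nonneg _

/-- mass of an event under the i.i.d. law -/
noncomputable def mass {Ω : Type*} [Fintype Ω] (μ : Ω → ℝ) {n : ℕ} (E : (Fin n → Ω) → Prop) : ℝ :=
  ∑ w : Fin n → Ω, ind (E w) * ∏ i, μ (w i)

lemma prod_sum_words {Ω : Type*} [Fintype Ω] {n : ℕ} (F : Fin n → Ω → ℝ) :
    ∏ i, ∑ ω, F i ω = ∑ w : Fin n → Ω, ∏ i, F i (w i) := by
  rw [Finset.prod_univ_sum, Fintype.piFinset_univ]

lemma prod_sum_fam {Ω κ : Type*} [Fintype Ω] [Fintype κ] [DecidableEq κ] (F : κ → Ω → ℝ) :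
    ∏ i, ∑ ω, F i ω = ∑ w : κ → Ω, ∏ i, F i (w i) := by
  rw [Finset.prod_univ_sum, Fintype.piFinset_univ]

/-- derivability -/
def Der {J : Type*} (N : J → ℕ) (δ : J → ℝ) {Ω : Type*} [Fintype Ω] (A : Set Ω)
    (E : ∀ j, (Fin (N j) → Ω) → Prop) : Prop :=
  ∃ μ : Ω → ℝ, (∀ ω, 0 ≤ μ ω) ∧ ∑ ω, μ ω = 1 ∧ (∀ ω ∈ A, 0 < μ ω) ∧
    ∃ k : ℕ, ∀ j, δ j ^ k ≤ mass μ (E j)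

section rules
variable {J : Type*} {N : J → ℕ} {δ : J → ℝ}

lemma Der.map {Ω Ω' : Type*} [Fintype Ω] [Fintype Ω'] {A : Set Ω} {A' : Set Ω'}
    {E : ∀ j, (Fin (N j) → Ω) → Prop} {E' : ∀ j, (Fin (N j) → Ω') → Prop}
    (h : Der N δ A E) (ψ : Ω → Ω') (hA : A' ⊆ ψ '' A)
    (hE : ∀ j w, E j w → E' j (fun i => ψ (w i))) : Der N δ A' E' := by
  obtain ⟨μ, h0, h1, hp, k, hk⟩ := h
  refine ⟨fun ω' => ∑ ω, ind (ψ ω = ω') * μ ω, ?_, ?_, ?_, k, ?_⟩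
  · intro ω'; exact sum_nonneg fun ω _ => mul_nonneg (ind_nonneg _) (h0 ω)
  · rw [sum_comm]
    simp_rw [← sum_mul]
    simpa [ind] using h1
  · intro ω' hω'
    obtain ⟨ω, hω, rfl⟩ := hA hω'
    refine lt_of_lt_of_le (hp ω hω) ?_
    have := single_le_sum (f := fun ω0 => ind (ψ ω0 = ψ ω) * μ ω0)
      (fun i _ => mul_nonneg (ind_nonneg _) (h0 i)) (mem_univ ω)
    simpa [ind] using this
  · intro j
    refine (hk j).trans ?_
    unfold mass
    simp_rw [prod_sum_words, mul_sum]
    rw [sum_comm]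
    refine sum_le_sum fun w _ => ?_
    refine le_trans ?_ (single_le_sum (f := fun w' : Fin (N j) → Ω' =>
      ind (E' j w') * ∏ i, (ind (ψ (w i) = w' i) * μ (w i))) ?_ (mem_univ (fun i => ψ (w i))))
    · simp only [ind_true, one_mul]
      exact mul_le_mul_of_nonneg_right (ind_mono (hE j w)) (prod_nonneg fun i _ => h0 _)
    · intro w' _
      exact mul_nonneg (ind_nonneg _) (prod_nonneg fun i _ => mul_nonneg (ind_nonneg _) (h0 _))

lemma Der.ext {Ω Ω' : Type*} [Fintype Ω] [Fintype Ω'] {A : Set Ω}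
    {E : ∀ j, (Fin (N j) → Ω) → Prop} (hδ : ∀ j, 0 ≤ δ j)
    (h : Der N δ A E) (κ : Ω → Ω' → ℝ) (κ0 : ∀ a b, 0 ≤ κ a b) (κ1 : ∀ a, ∑ b, κ a b = 1)
    (F : ∀ j, (Fin (N j) → Ω) → (Fin (N j) → Ω') → Prop) (k0 : ℕ)
    (hF : ∀ j w, E j w → δ j ^ k0 ≤ ∑ w' : Fin (N j) → Ω', ind (F j w w') * ∏ i, κ (w i) (w' i)) :
    Der N δ {p : Ω × Ω' | p.1 ∈ A ∧ 0 < κ p.1 p.2}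
      (fun j w => E j (fun i => (w i).1) ∧ F j (fun i => (w i).1) (fun i => (w i).2)) := by
  obtain ⟨μ, h0, h1, hp, k, hk⟩ := h
  refine ⟨fun p => μ p.1 * κ p.1 p.2, ?_, ?_, ?_, k + k0, ?_⟩
  · intro p; exact mul_nonneg (h0 _) (κ0 _ _)
  · rw [Fintype.sum_prod_type]
    simp_rw [← mul_sum, κ1, mul_one]; exact h1
  · rintro ⟨a, b⟩ ⟨ha, hb⟩; exact mul_pos (hp _ ha) hb
  · intro j
    rw [pow_add]
    have e : mass (fun p : Ω × Ω' => μ p.1 * κ p.1 p.2)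
        (fun w : Fin (N j) → Ω × Ω' => E j (fun i => (w i).1) ∧ F j (fun i => (w i).1) (fun i => (w i).2))
        = ∑ w : Fin (N j) → Ω, ∑ w' : Fin (N j) → Ω',
          ind (E j w ∧ F j w w') * ∏ i, (μ (w i) * κ (w i) (w' i)) := by
      unfold mass
      rw [← Fintype.sum_prod_type']
      exact Fintype.sum_equiv (Equiv.arrowProdEquivProdArrow _ _ _) _ _ (fun w => rfl)
    rw [e]
    calc δ j ^ k * δ j ^ k0 ≤ mass μ (E j) * δ j ^ k0 :=
          mul_le_mul_of_nonneg_right (hk j) (pow_nonneg (hδ j) _)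
      _ = ∑ w : Fin (N j) → Ω, (ind (E j w) * ∏ i, μ (w i)) * δ j ^ k0 := by rw [mass, sum_mul]
      _ ≤ _ := by
        refine sum_le_sum fun w _ => ?_
        by_cases hE : E j w
        · have : ∑ w' : Fin (N j) → Ω', ind (E j w ∧ F j w w') * ∏ i, (μ (w i) * κ (w i) (w' i))
            = (∏ i, μ (w i)) * ∑ w' : Fin (N j) → Ω', ind (F j w w') * ∏ i, κ (w i) (w' i) := by
            rw [mul_sum]
            refine sum_congr rfl fun w' _ => ?_
            rw [prod_mul_distrib]; simp only [hE, true_and]; ring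
          rw [this, ind_true hE, one_mul]
          exact mul_le_mul_of_nonneg_left (hF j w hE) (prod_nonneg fun i _ => h0 _)
        · rw [ind_false hE]; simp only [zero_mul]
          exact sum_nonneg fun w' _ => mul_nonneg (ind_nonneg _)
            (prod_nonneg fun i _ => mul_nonneg (h0 _) (κ0 _ _))

lemma Der.copy {Ω Ψ κ : Type*} [Fintype Ω] [Fintype Ψ] [Fintype κ] [DecidableEq κ] [Nonempty κ] {A : Set Ω}
    {E : ∀ j, (Fin (N j) → Ω) → Prop} (hδ : ∀ j, 0 ≤ δ j)
    (h : Der N δ A E) (φ : Ω → Ψ) :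
    Der N δ {o : κ → Ω | (∀ k, o k ∈ A) ∧ ∀ k k', φ (o k) = φ (o k')}
      (fun j w => (∀ k, E j (fun i => w i k)) ∧ ∀ i k k', φ (w i k) = φ (w i k')) := by
  obtain ⟨μ, h0, h1, hp, k, hk⟩ := h
  set ν : Ψ → ℝ := fun ψ => ∑ ω, ind (φ ω = ψ) * μ ω with hν
  set r : Ψ → Ω → ℝ := fun ψ ω => ind (φ ω = ψ) * μ ω / ν ψ with hr
  have ν0 : ∀ ψ, 0 ≤ ν ψ := fun ψ => sum_nonneg fun ω _ => mul_nonneg (ind_nonneg _) (h0 ω)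
  have r0 : ∀ ψ ω, 0 ≤ r ψ ω := fun ψ ω =>
    div_nonneg (mul_nonneg (ind_nonneg _) (h0 ω)) (ν0 ψ)
  have νle : ∀ ψ ω, ind (φ ω = ψ) * μ ω ≤ ν ψ := fun ψ ω =>
    single_le_sum (f := fun ω => ind (φ ω = ψ) * μ ω)
      (fun i _ => mul_nonneg (ind_nonneg _) (h0 i)) (mem_univ ω)
  have νr : ∀ ψ ω, ν ψ * r ψ ω = ind (φ ω = ψ) * μ ω := by
    intro ψ ω
    by_cases hz : ν ψ = 0
    · have := νle ψ ω
      rw [hz] at this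
      rw [hz, zero_mul]
      exact le_antisymm (mul_nonneg (ind_nonneg _) (h0 ω)) this
    · simp only [hr]; field_simp
  have νsum : ∑ ψ, ν ψ = 1 := by
    simp only [hν]
    rw [sum_comm]; simp_rw [← sum_mul]; simpa [ind] using h1
  have rsum : ∀ ψ, ν ψ ≠ 0 → ∑ ω, r ψ ω = 1 := by
    intro ψ hψ
    simp only [hr]
    rw [← sum_div]; exact div_self hψ
  have μsum : ∀ ω, μ ω = ∑ ψ, ν ψ * r ψ ω := by
    intro ω; simp_rw [νr, ← sum_mul]; simp [ind]
  refine ⟨fun o => ∑ ψ, ν ψ * ∏ k, r ψ (o k), ?_, ?_, ?_, k * Fintype.card κ, ?_⟩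
  · intro o; exact sum_nonneg fun ψ _ => mul_nonneg (ν0 _) (prod_nonneg fun k _ => r0 _ _)
  · rw [sum_comm]
    simp_rw [← mul_sum]
    rw [← νsum]
    refine sum_congr rfl fun ψ _ => ?_
    rw [← prod_sum_fam (fun _ => r ψ)]
    by_cases hz : ν ψ = 0
    · simp [hz]
    · simp [rsum ψ hz]
  · rintro o ⟨hoA, hoφ⟩
    obtain ⟨k1⟩ := ‹Nonempty κ›
    have hνp : 0 < ν (φ (o k1)) := by
      refine lt_of_lt_of_le (hp _ (hoA k1)) ?_
      simpa [ind] using νle (φ (o k1)) (o k1)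
    refine lt_of_lt_of_le ?_ (single_le_sum (f := fun ψ => ν ψ * ∏ k, r ψ (o k))
      (fun ψ _ => mul_nonneg (ν0 _) (prod_nonneg fun k _ => r0 _ _)) (mem_univ (φ (o k1))))
    refine mul_pos hνp (prod_pos fun k _ => ?_)
    simp only [hr]
    rw [ind_true (hoφ k k1), one_mul]
    exact div_pos (hp _ (hoA k)) hνp
  · intro j
    set q : (Fin (N j) → Ψ) → ℝ := fun v =>
      ∑ w : Fin (N j) → Ω, ind (E j w) * ∏ i, r (v i) (w i) with hq
    have q0 : ∀ v, 0 ≤ q v := fun v => sum_nonneg fun w _ =>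
      mul_nonneg (ind_nonneg _) (prod_nonneg fun i _ => r0 _ _)
    have e1 : mass μ (E j) = ∑ v : Fin (N j) → Ψ, (∏ i, ν (v i)) * q v := by
      unfold mass
      simp only [hq, mul_sum]
      rw [sum_comm]
      refine sum_congr rfl fun w _ => ?_
      have : ∏ i, μ (w i) = ∑ v : Fin (N j) → Ψ, ∏ i, (ν (v i) * r (v i) (w i)) := by
        rw [← prod_sum_words (fun i ψ => ν ψ * r ψ (w i))]
        exact prod_congr rfl fun i _ => μsum _
      rw [this, mul_sum]
      refine sum_congr rfl fun v _ => ?_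
      rw [prod_mul_distrib]; ring
    have s1 : ∑ v : Fin (N j) → Ψ, ∏ i, ν (v i) = 1 := by
      rw [← prod_sum_words (fun _ => ν)]; simp [νsum]
    rw [pow_mul]
    calc (δ j ^ k) ^ Fintype.card κ ≤ (mass μ (E j)) ^ Fintype.card κ :=
          pow_le_pow_left₀ (pow_nonneg (hδ j) _) (hk j) _
      _ ≤ ∑ v : Fin (N j) → Ψ, (∏ i, ν (v i)) * q v ^ Fintype.card κ := by
          rw [e1]
          exact Real.pow_arith_mean_le_arith_mean_pow univ _ _
            (fun v _ => prod_nonneg fun i _ => ν0 _) s1 (fun v _ => q0 v) _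
      _ = ∑ v : Fin (N j) → Ψ, ∑ W : κ → Fin (N j) → Ω,
            (∏ i, ν (v i)) * ∏ k, (ind (E j (W k)) * ∏ i, r (v i) (W k i)) := by
          refine sum_congr rfl fun v _ => ?_
          rw [← mul_sum, ← prod_sum_fam (fun (_ : κ) (w : Fin (N j) → Ω) =>
            ind (E j w) * ∏ i, r (v i) (w i))]
          simp [hq]
      _ = ∑ v : Fin (N j) → Ψ, ∑ W : Fin (N j) → κ → Ω,
            (∏ i, ν (v i)) * ∏ k, (ind (E j (fun i => W i k)) * ∏ i, r (v i) (W i k)) := by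
          refine sum_congr rfl fun v _ => ?_
          exact Fintype.sum_equiv (Equiv.piComm _) _ _ (fun W => rfl)
      _ ≤ _ := by
          unfold mass
          simp_rw [prod_sum_words, mul_sum]
          rw [sum_comm]
          refine sum_le_sum fun W _ => sum_le_sum fun v _ => ?_
          rw [prod_mul_distrib, prod_mul_distrib, prod_comm]
          rw [mul_left_comm]
          by_cases hc : ∀ i k, φ (W i k) = v i
          · refine mul_le_mul_of_nonneg_right ?_ (mul_nonneg (prod_nonneg fun i _ => ν0 _)
              (prod_nonneg fun i _ => prod_nonneg fun i _ => r0 _ _))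
            by_cases hE : ∀ k, E j (fun i => W i k)
            · rw [ind_true ⟨hE, fun i k k' => by rw [hc, hc]⟩]
              exact prod_le_one (fun k _ => ind_nonneg _) (fun k _ => ind_le_one _)
            · push Not at hE
              obtain ⟨k, hk⟩ := hE
              rw [prod_eq_zero (mem_univ k) (ind_false hk)]
              exact ind_nonneg _
          · push Not at hc
            obtain ⟨i, k, hik⟩ := hc
            have : ∏ i, ∏ k, r (v i) (W i k) = 0 := by
              refine prod_eq_zero (mem_univ i) (prod_eq_zero (mem_univ k) ?_)
              simp only [hr]; rw [ind_false hik]; simp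
            rw [this]; simp

lemma Der.final {Ω : Type*} [Fintype Ω] {A : Set Ω}
    {E : ∀ j, (Fin (N j) → Ω) → Prop} 
    (h : Der N δ A E) (o : Ω) (ho : o ∈ A) (hE : ∀ j w, E j w → ∀ i, w i ≠ o) :
    ∃ k : ℕ, ∃ q : ℝ, 0 ≤ q ∧ q < 1 ∧ ∀ j, δ j ^ k ≤ q ^ N j := by
  obtain ⟨μ, h0, h1, hp, k, hk⟩ := h
  have hle : μ o ≤ 1 := by
    rw [← h1]; exact single_le_sum (fun i _ => h0 i) (mem_univ o)
  refine ⟨k, 1 - μ o, by linarith, by linarith [hp o ho], fun j => (hk j).trans ?_⟩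
  have : (1 - μ o) ^ N j = ∑ w : Fin (N j) → Ω, ∏ i, (ind (w i ≠ o) * μ (w i)) := by
    rw [← prod_sum_words (fun _ ω => ind (ω ≠ o) * μ ω)]
    have : ∑ ω, ind (ω ≠ o) * μ ω = 1 - μ o := by
      have e : ∀ ω, ind (ω ≠ o) * μ ω = μ ω - if ω = o then μ ω else 0 := by
        intro ω; by_cases hω : ω = o <;> simp [ind, hω]
      simp_rw [e, sum_sub_distrib, h1]; simp
    simp [this]
  rw [this]
  refine sum_le_sum fun w _ => ?_
  by_cases hw : E j w
  · rw [ind_true hw, one_mul]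
    refine prod_le_prod (fun i _ => h0 _) fun i _ => ?_
    rw [ind_true (hE j w hw i), one_mul]
  · rw [ind_false hw, zero_mul]
    exact prod_nonneg fun i _ => mul_nonneg (ind_nonneg _) (h0 _)

end rules

/-- iterated two-step relation -/
def itr {V : Type*} (r : V → V → Prop) : ℕ → V → V → Prop
  | 0 => r
  | s + 1 => fun a b => ∃ c, itr r s a c ∧ itr r s b c

lemma itr_refl {V : Type*} {r : V → V → Prop} (h : ∀ a, r a a) (s : ℕ) (a : V) : itr r s a a := by
  induction s with
  | zero => exact h a
  | succ s ih => exact ⟨a, ih, ih⟩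

lemma itr_symm {V : Type*} {r : V → V → Prop} (h : ∀ a b, r a b → r b a) (s : ℕ) (a b : V)
    (hab : itr r s a b) : itr r s b a := by
  cases s with
  | zero => exact h _ _ hab
  | succ s => obtain ⟨c, h1, h2⟩ := hab; exact ⟨c, h2, h1⟩

lemma itr_succ {V : Type*} {r : V → V → Prop} (h : ∀ a, r a a) (s : ℕ) (a b : V)
    (hab : itr r s a b) : itr r (s + 1) a b := ⟨b, hab, itr_refl h s b⟩

lemma itr_mono {V : Type*} {r : V → V → Prop} (h : ∀ a, r a a) {s s' : ℕ} (hs : s ≤ s') (a b : V)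
    (hab : itr r s a b) : itr r s' a b := by
  induction hs with
  | refl => exact hab
  | step _ ih => exact itr_succ h _ _ _ ih

lemma itr_total {V : Type*} [Fintype V] {r : V → V → Prop} (h : ∀ a, r a a)
    (hs : ∀ a b, r a b → r b a) (hc : ∀ a b, Relation.ReflTransGen r a b) :
    ∃ s, ∀ a b, itr r s a b := by
  have h1 : ∀ p : V × V, ∃ s, itr r s p.1 p.2 := by
    rintro ⟨a, b⟩
    induction hc a b with
    | refl => exact ⟨0, h a⟩
    | tail _ hbc ih =>
      obtain ⟨s, ih⟩ := ih
      exact ⟨s + 1, _, ih, itr_mono h (Nat.zero_le s) _ _ (hs _ _ hbc)⟩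
  choose s hs using h1
  refine ⟨univ.sup s, fun a b => ?_⟩
  exact itr_mono h (le_sup (f := s) (mem_univ (a, b))) _ _ (hs (a, b))

/-- all game data, indexed by an abstract family of instances -/
structure GD (J X Y Z S A : Type*) [Fintype X] [Fintype Y] [Fintype Z] [Fintype S]
    [AddCommGroup A] where
  N : J → ℕ
  δ : J → ℝ
  hδ : ∀ j, 0 ≤ δ j
  f : ∀ j, (Fin (N j) → X) → Fin (N j) → A
  g : ∀ j, (Fin (N j) → Y) → Fin (N j) → A
  h : ∀ j, (Fin (N j) → Z) → Fin (N j) → A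
  xS : S → X
  yS : S → Y
  zS : S → Z
  t : S → A
  SS : ∀ j, Set (Fin (N j) → X)
  κ : X → S → ℝ
  κ0 : ∀ a b, 0 ≤ κ a b
  κ1 : ∀ a, ∑ b, κ a b = 1
  κp : ∀ s, 0 < κ (xS s) s
  hatt : ∀ j x, x ∈ SS j → δ j ≤ ∑ w : Fin (N j) → S,
    ind ((∀ i, f j (fun i => xS (w i)) i + g j (fun i => yS (w i)) i + h j (fun i => zS (w i)) i
      = t (w i)) ∧ ∀ i, xS (w i) = x i) * ∏ i, κ (x i) (w i)
  base : Der N δ (Set.univ : Set X) (fun j w => w ∈ SS j)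
  xsurj : Function.Surjective xS
  ysurj : Function.Surjective yS
  zsurj : Function.Surjective zS
  cXY : ∀ a b, Relation.ReflTransGen (fun a b => ∃ s s', xS s = a ∧ xS s' = b ∧ yS s = yS s') a b
  cXZ : ∀ a b, Relation.ReflTransGen (fun a b => ∃ s s', xS s = a ∧ xS s' = b ∧ zS s = zS s') a b
  cYZ : ∀ a b, Relation.ReflTransGen (fun a b => ∃ s s', yS s = a ∧ yS s' = b ∧ zS s = zS s') a b

namespace GD
variable {J X Y Z S A : Type*} [Fintype X] [Fintype Y] [Fintype Z] [Fintype S]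
    [AddCommGroup A] (D : GD J X Y Z S A)

def Win (j : J) (w : Fin (D.N j) → S) : Prop :=
  ∀ i, D.f j (fun i => D.xS (w i)) i + D.g j (fun i => D.yS (w i)) i
    + D.h j (fun i => D.zS (w i)) i = D.t (w i)

lemma attach {Ω ι : Type*} [Fintype Ω] [Fintype ι] [DecidableEq ι] {A : Set Ω}
    {E : ∀ j, (Fin (D.N j) → Ω) → Prop} (hD : Der D.N D.δ A E) (xl : ι → Ω → X)
    (hE : ∀ j w, E j w → ∀ l, (fun i => xl l (w i)) ∈ D.SS j) :
    Der D.N D.δ {p : Ω × (ι → S) | p.1 ∈ A ∧ ∀ l, D.xS (p.2 l) = xl l p.1}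
      (fun j w => E j (fun i => (w i).1) ∧ ∀ l, D.Win j (fun i => (w i).2 l) ∧
        ∀ i, D.xS ((w i).2 l) = xl l (w i).1) := by
  have := hD.ext D.hδ (Ω' := ι → S) (fun ω ξ => ∏ l, D.κ (xl l ω) (ξ l))
    (fun ω ξ => prod_nonneg fun l _ => D.κ0 _ _)
    (fun ω => by rw [← prod_sum_fam (fun l s => D.κ (xl l ω) s)]; simp [D.κ1])
    (fun j w w' => ∀ l, D.Win j (fun i => w' i l) ∧ ∀ i, D.xS (w' i l) = xl l (w i))
    (Fintype.card ι) ?_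
  · refine this.map id ?_ (fun j w hw => hw)
    rintro ⟨ω, ξ⟩ ⟨h1, h2⟩
    refine ⟨(ω, ξ), ⟨h1, prod_pos fun l _ => ?_⟩, rfl⟩
    have := D.κp (ξ l)
    rwa [h2] at this
  · intro j w hw
    calc D.δ j ^ Fintype.card ι = ∏ l : ι, D.δ j := by simp
      _ ≤ ∏ l : ι, ∑ v : Fin (D.N j) → S, ind (D.Win j v ∧ ∀ i, D.xS (v i) = xl l (w i))
            * ∏ i, D.κ (xl l (w i)) (v i) :=
          prod_le_prod (fun _ _ => D.hδ j) (fun l _ => D.hatt j _ (hE j w hw l))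
      _ = ∑ W : ι → Fin (D.N j) → S, ∏ l, (ind (D.Win j (W l) ∧ ∀ i, D.xS (W l i) = xl l (w i))
            * ∏ i, D.κ (xl l (w i)) (W l i)) := by
          rw [prod_sum_fam (fun l (v : Fin (D.N j) → S) =>
            ind (D.Win j v ∧ ∀ i, D.xS (v i) = xl l (w i)) * ∏ i, D.κ (xl l (w i)) (v i))]
      _ = ∑ W : Fin (D.N j) → ι → S, ∏ l, (ind (D.Win j (fun i => W i l) ∧
            ∀ i, D.xS (W i l) = xl l (w i)) * ∏ i, D.κ (xl l (w i)) (W i l)) :=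
          Fintype.sum_equiv (Equiv.piComm _) _ _ (fun W => rfl)
      _ ≤ _ := by
          refine sum_le_sum fun W _ => ?_
          rw [prod_mul_distrib, prod_comm]
          refine mul_le_mul_of_nonneg_right ?_ 
            (prod_nonneg fun i _ => prod_nonneg fun l _ => D.κ0 _ _)
          by_cases hW : ∀ l, D.Win j (fun i => W i l) ∧ ∀ i, D.xS (W i l) = xl l (w i)
          · rw [ind_true hW]
            exact prod_le_one (fun k _ => ind_nonneg _) (fun k _ => ind_le_one _)
          · rw [ind_false hW]
            rw [not_forall] at hW
            obtain ⟨l, hl⟩ := hW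
            rw [prod_eq_zero (mem_univ l) (ind_false hl)]

/-- mixing two words according to a predicate on the context -/
noncomputable def mix {C L : Type*} {n : ℕ} (P : C → Prop) (c : Fin n → C) (u v : Fin n → L) : Fin n → L :=
  fun i => if P (c i) then u i else v i

lemma mix_not {C L : Type*} {n : ℕ} (P : C → Prop) (c : Fin n → C) (u v : Fin n → L) :
    mix (fun c => ¬ P c) c u v = mix P c v u := by
  funext i; by_cases h : P (c i) <;> simp [mix, h]

def SwapEv {C : Type*} (P : C → Prop) (E : ∀ j, (Fin (D.N j) → C) → (Fin (D.N j) → X) → Prop)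
    (j : J) (c : Fin (D.N j) → C) (l0 l1 : Fin (D.N j) → X) : Prop :=
  E j c l0 ∧ E j c l1 ∧ E j c (mix P c l0 l1) ∧ E j c (mix P c l1 l0) ∧
    ∀ i, D.f j l0 i + D.f j l1 i = D.f j (mix P c l0 l1) i + D.f j (mix P c l1 l0) i

lemma swapEv_not {C : Type*} {P : C → Prop} {E : ∀ j, (Fin (D.N j) → C) → (Fin (D.N j) → X) → Prop}
    {j : J} {c : Fin (D.N j) → C} {l0 l1 : Fin (D.N j) → X} :
    D.SwapEv (fun c => ¬ P c) E j c l0 l1 ↔ D.SwapEv P E j c l0 l1 := by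
  unfold SwapEv
  rw [mix_not, mix_not]
  constructor
  · rintro ⟨a, b, c, d, e⟩; exact ⟨a, b, d, c, fun i => by rw [e i, add_comm]⟩
  · rintro ⟨a, b, c, d, e⟩; exact ⟨a, b, d, c, fun i => by rw [e i, add_comm]⟩

def SwapD {C : Type*} [Fintype C] (P : C → Prop)
    (E : ∀ j, (Fin (D.N j) → C) → (Fin (D.N j) → X) → Prop) (rP rQ : X → X → Prop) : Prop :=
  Der D.N D.δ {p : C × X × X | (P p.1 → rP p.2.1 p.2.2) ∧ (¬ P p.1 → rQ p.2.1 p.2.2)}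
    (fun j w => D.SwapEv P E j (fun i => (w i).1) (fun i => (w i).2.1) (fun i => (w i).2.2))

lemma swapD_not {C : Type*} [Fintype C] {P : C → Prop}
    {E : ∀ j, (Fin (D.N j) → C) → (Fin (D.N j) → X) → Prop} {rP rQ : X → X → Prop}
    (h : D.SwapD P E rP rQ) : D.SwapD (fun c => ¬ P c) E rQ rP := by
  refine h.map id ?_ ?_
  · rintro p ⟨h1, h2⟩
    exact ⟨p, ⟨fun h => h2 (not_not.2 h), h1⟩, rfl⟩
  · intro j w hw; exact D.swapEv_not.2 hw

lemma swapD_not' {C : Type*} [Fintype C] {P : C → Prop}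
    {E : ∀ j, (Fin (D.N j) → C) → (Fin (D.N j) → X) → Prop} {rP rQ : X → X → Prop}
    (h : D.SwapD (fun c => ¬ P c) E rQ rP) : D.SwapD P E rP rQ := by
  refine h.map id ?_ ?_
  · rintro p ⟨h1, h2⟩
    exact ⟨p, ⟨h2, fun h => h1 (not_not.1 h)⟩, rfl⟩
  · intro j w hw; exact D.swapEv_not.1 hw

lemma swap_step {C : Type*} [Fintype C] {P : C → Prop}
    {E : ∀ j, (Fin (D.N j) → C) → (Fin (D.N j) → X) → Prop} {rP rQ : X → X → Prop}
    (h : D.SwapD P E rP rQ) : D.SwapD P E (fun a b => ∃ c, rP a c ∧ rP b c) rQ := by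
  have h1 := Der.copy (κ := Bool) D.hδ h (fun p => (p.1, if P p.1 then (Sum.inl p.2.2 : X ⊕ (X × X)) else Sum.inr p.2))
  refine h1.map (fun o => ((o false).1, (o false).2.1,
    if P (o false).1 then (o true).2.1 else (o false).2.2)) ?_ ?_
  · rintro ⟨c, m0, m1⟩ ⟨hp, hq⟩
    by_cases hc : P c
    · obtain ⟨a, h0, h1⟩ := hp hc
      refine ⟨fun b => if b then (c, m1, a) else (c, m0, a), ⟨?_, ?_⟩, ?_⟩
      · intro b; cases b <;> simp [hc, h0, h1]
      · intro b b'; cases b <;> cases b' <;> simp [hc]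
      · simp [hc]
    · refine ⟨fun b => (c, m0, m1), ⟨?_, ?_⟩, ?_⟩
      · intro b; exact ⟨fun h => (hc h).elim, hq⟩
      · intro b b'; rfl
      · simp [hc]
  · rintro j w ⟨hE, hφ⟩
    obtain ⟨a1, a2, a3, a4, a5⟩ := hE false
    obtain ⟨b1, b2, b3, b4, b5⟩ := hE true
    have hc : ∀ i, (w i true).1 = (w i false).1 := fun i => (Prod.ext_iff.1 (hφ i true false)).1
    have hφ2 : ∀ i, (if P (w i true).1 then (Sum.inl (w i true).2.2 : X ⊕ (X × X)) else Sum.inr (w i true).2)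
      = (if P (w i false).1 then (Sum.inl (w i false).2.2 : X ⊕ (X × X)) else Sum.inr (w i false).2) :=
        fun i => (Prod.ext_iff.1 (hφ i true false)).2
    have hcw : (fun i => (w i true).1) = (fun i => (w i false).1) := funext hc
    rw [hcw] at b1 b2 b3 b4 b5
    set c := (fun i => (w i false).1) with hcdef
    set l0 := (fun i => (w i false).2.1) with hl0
    set l1 := (fun i => (w i false).2.2) with hl1
    set l0' := (fun i => (w i true).2.1) with hl0'
    set l1' := (fun i => (w i true).2.2) with hl1'
    have key : ∀ i, l1' i = l1 i ∧ (¬ P (c i) → l0' i = l0 i) := by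
      intro i
      have := hφ2 i
      rw [hc i] at this
      by_cases hp : P (w i false).1
      · simp only [hp, if_true, Sum.inl.injEq] at this
        exact ⟨this, fun h => (h hp).elim⟩
      · simp only [hp, if_false, Sum.inr.injEq] at this
        exact ⟨congrArg Prod.snd this, fun _ => congrArg Prod.fst this⟩
    have e1 : l1' = l1 := funext fun i => (key i).1
    rw [e1] at b2 b3 b4 b5
    have e2 : mix P c l1 l0' = mix P c l1 l0 := by
      funext i; unfold mix; split_ifs with hp
      · rfl
      · exact (key i).2 hp
    rw [e2] at b4 b5
    have e3 : mix P c l0 (mix P c l0' l1) = mix P c l0 l1 := by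
      funext i; unfold mix; split_ifs <;> rfl
    have e4 : mix P c (mix P c l0' l1) l0 = l0' := by
      funext i; unfold mix; split_ifs with hp
      · rfl
      · exact ((key i).2 hp).symm
    change D.SwapEv P E j c l0 (mix P c l0' l1)
    refine ⟨a1, b3, ?_, ?_, ?_⟩
    · rw [e3]; exact a3
    · rw [e4]; exact b1
    · intro i
      rw [e3, e4]
      have h5 := a5 i
      have h6 := b5 i
      have h7 : D.f j l0 i = D.f j (mix P c l0 l1) i + D.f j (mix P c l1 l0) i - D.f j l1 i :=
        eq_sub_of_add_eq h5
      have h8 : D.f j l0' i = D.f j (mix P c l0' l1) i + D.f j (mix P c l1 l0) i - D.f j l1 i :=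
        eq_sub_of_add_eq h6
      rw [h7, h8]; abel

lemma swap_iter {C : Type*} [Fintype C] {P : C → Prop}
    {E : ∀ j, (Fin (D.N j) → C) → (Fin (D.N j) → X) → Prop} {rP rQ : X → X → Prop}
    (h : D.SwapD P E rP rQ) (s : ℕ) : D.SwapD P E (itr rP s) rQ := by
  induction s with
  | zero => exact h
  | succ s ih => exact D.swap_step ih

def shareXY (a b : X) : Prop := ∃ s s', D.xS s = a ∧ D.xS s' = b ∧ D.yS s = D.yS s'
def shareXZ (a b : X) : Prop := ∃ s s', D.xS s = a ∧ D.xS s' = b ∧ D.zS s = D.zS s'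
def shareYZ (a b : Y) : Prop := ∃ s s', D.yS s = a ∧ D.yS s' = b ∧ D.zS s = D.zS s'

lemma totXY : ∃ s, ∀ a b, itr D.shareXY s a b := by
  refine itr_total (fun a => ?_) (fun a b => ?_) D.cXY
  · obtain ⟨s, hs⟩ := D.xsurj a; exact ⟨s, s, hs, hs, rfl⟩
  · rintro ⟨s, s', h1, h2, h3⟩; exact ⟨s', s, h2, h1, h3.symm⟩
lemma totXZ : ∃ s, ∀ a b, itr D.shareXZ s a b := by
  refine itr_total (fun a => ?_) (fun a b => ?_) D.cXZ
  · obtain ⟨s, hs⟩ := D.xsurj a; exact ⟨s, s, hs, hs, rfl⟩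
  · rintro ⟨s, s', h1, h2, h3⟩; exact ⟨s', s, h2, h1, h3.symm⟩
lemma reflYZ (a : Y) : D.shareYZ a a := by
  obtain ⟨s, hs⟩ := D.ysurj a; exact ⟨s, s, hs, hs, rfl⟩
lemma totYZ : ∃ s, ∀ a b, itr D.shareYZ s a b := by
  refine itr_total D.reflYZ (fun a b => ?_) D.cYZ
  · rintro ⟨s, s', h1, h2, h3⟩; exact ⟨s', s, h2, h1, h3.symm⟩

lemma swap_base {C : Type*} [Fintype C] (P : C → Prop)
    {E : ∀ j, (Fin (D.N j) → C) → (Fin (D.N j) → X) → Prop}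
    (h : Der D.N D.δ (Set.univ : Set (C × X)) (fun j w => E j (fun i => (w i).1) (fun i => (w i).2)))
    (hE : ∀ j c x, E j c x → x ∈ D.SS j) :
    D.SwapD P E D.shareXY D.shareXZ := by
  have h1 := D.attach h (ι := Unit) (fun _ p => p.2) (fun j w hw _ => hE j _ _ hw)
  have h2 : Der D.N D.δ (Set.univ : Set (C × S)) (fun j w =>
      E j (fun i => (w i).1) (fun i => D.xS (w i).2) ∧ D.Win j (fun i => (w i).2)) := by
    refine h1.map (fun p => (p.1.1, p.2 ())) ?_ ?_
    · rintro ⟨c, s⟩ _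
      exact ⟨((c, D.xS s), fun _ => s), ⟨trivial, fun _ => rfl⟩, rfl⟩
    · rintro j w ⟨hw, hw2⟩
      obtain ⟨hwin, hx⟩ := hw2 ()
      refine ⟨?_, hwin⟩
      have : (fun i => D.xS ((w i).2 ())) = fun i => (w i).1.2 := funext hx
      simp only [this]; exact hw
  have h3 := Der.copy (κ := Bool) D.hδ h2
    (fun p => (p.1, if P p.1 then (Sum.inl p.2 : S ⊕ Z) else Sum.inr (D.zS p.2)))
  have h4 := Der.copy (κ := Bool) D.hδ h3
    (fun o => ((o false).1, if P (o false).1 then (Sum.inl (D.yS (o false).2) : Y ⊕ (Bool → C × S))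
      else Sum.inr o))
  refine h4.map (fun O => ((O false false).1, D.xS (O false false).2, D.xS (O true true).2)) ?_ ?_
  · rintro ⟨c, l0, l1⟩ ⟨hp, hq⟩
    by_cases hc : P c
    · obtain ⟨s, s', rfl, rfl, h3⟩ := hp hc
      refine ⟨fun a b => (c, if a then s' else s), ⟨?_, ?_⟩, ?_⟩
      · intro a; exact ⟨fun _ => trivial, fun b b' => rfl⟩
      · intro a a'; cases a <;> cases a' <;> simp [hc, h3]
      · simp
    · obtain ⟨s, s', rfl, rfl, h3⟩ := hq hc
      refine ⟨fun a b => (c, if b then s' else s), ⟨?_, ?_⟩, ?_⟩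
      · intro a; refine ⟨fun _ => trivial, fun b b' => ?_⟩
        cases b <;> cases b' <;> simp [hc, h3]
      · intro a a'; rfl
      · simp
  · rintro j w ⟨hE1, hφ⟩
    have hEE := fun a b => (hE1 a).1 b
    have hφ1 := fun a => (hE1 a).2
    -- contexts agree
    have hc0 : ∀ i a b, (w i a b).1 = (w i false false).1 := by
      intro i a b
      have h1 := (Prod.ext_iff.1 (hφ1 a i b false)).1
      have h2 := (Prod.ext_iff.1 (hφ i a false)).1
      exact h1.trans h2
    have hP : ∀ i a b, P (w i false false).1 → (w i a b).2 = (w i a false).2 ∧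
        D.yS (w i a b).2 = D.yS (w i false false).2 := by
      intro i a b hp
      have h1 := (Prod.ext_iff.1 (hφ1 a i b false)).2
      have h2 := (Prod.ext_iff.1 (hφ i a false)).2
      simp only [hc0 i a, hp, if_true, Sum.inl.injEq] at h1 h2
      exact ⟨h1, by rw [h1]; exact h2⟩
    have hQ : ∀ i a b, ¬ P (w i false false).1 → (w i a b).2 = (w i false b).2 ∧
        D.zS (w i a b).2 = D.zS (w i a false).2 := by
      intro i a b hp
      have h1 := (Prod.ext_iff.1 (hφ1 a i b false)).2
      have h2 := (Prod.ext_iff.1 (hφ i a false)).2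
      simp only [hc0 i a, hp, if_false, Sum.inr.injEq] at h1 h2
      exact ⟨by rw [h2], h1⟩
    have hcw : ∀ a b, (fun i => (w i a b).1) = fun i => (w i false false).1 :=
      fun a b => funext fun i => hc0 i a b
    set c := fun i => (w i false false).1 with hcdef
    set x : Bool → Bool → Fin (D.N j) → X := fun a b i => D.xS (w i a b).2 with hx
    have hEx : ∀ a b, E j c (x a b) := by
      intro a b; have := (hEE a b).1; rw [hcw a b] at this; exact this
    have m1 : mix P c (x false false) (x true true) = x false true := by
      funext i; unfold mix; simp only [hx]; split_ifs with hp
      · rw [(hP i false true hp).1]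
      · rw [(hQ i true true hp).1]
    have m2 : mix P c (x true true) (x false false) = x true false := by
      funext i; unfold mix; simp only [hx]; split_ifs with hp
      · rw [(hP i true true hp).1]
      · rw [(hQ i true false hp).1]
    have ey : ∀ b, (fun i => D.yS (w i true b).2) = (fun i => D.yS (w i false b).2) := by
      intro b; funext i
      by_cases hp : P (c i)
      · rw [(hP i true b hp).2, (hP i false b hp).2]
      · rw [(hQ i true b hp).1]
    have ez : ∀ a, (fun i => D.zS (w i a true).2) = (fun i => D.zS (w i a false).2) := by
      intro a; funext i
      by_cases hp : P (c i)
      · rw [(hP i a true hp).1]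
      · rw [(hQ i a true hp).2]
    change D.SwapEv P E j c (x false false) (x true true)
    refine ⟨hEx _ _, hEx _ _, ?_, ?_, fun i => ?_⟩
    · rw [m1]; exact hEx _ _
    · rw [m2]; exact hEx _ _
    · rw [m1, m2]
      have w00 := (hEE false false).2 i
      have w01 := (hEE false true).2 i
      have w10 := (hEE true false).2 i
      have w11 := (hEE true true).2 i
      rw [ez] at w01 w11
      rw [ey] at w10 w11
      have hT : D.t (w i false false).2 + D.t (w i true true).2
          = D.t (w i false true).2 + D.t (w i true false).2 := by
        by_cases hp : P (c i)
        · rw [(hP i true true hp).1, (hP i false true hp).1]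
        · rw [(hQ i true true hp).1, (hQ i true false hp).1, add_comm]
      rw [← w00, ← w01, ← w10, ← w11] at hT
      have hT2 : ∀ a b c d g g' h h' : A, a + g + h + (b + g' + h') = c + g' + h + (d + g + h') →
          a + b = c + d := by
        intro a b c d g g' h h' H
        have H1 : a + g + h + (b + g' + h') = (a + b) + (g + h + g' + h') := by abel
        have H2 : c + g' + h + (d + g + h') = (c + d) + (g + h + g' + h') := by abel
        rw [H1, H2] at H
        exact add_right_cancel H
      exact hT2 _ _ _ _ _ _ _ _ hT

lemma swap {C : Type*} [Fintype C] (P : C → Prop)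
    {E : ∀ j, (Fin (D.N j) → C) → (Fin (D.N j) → X) → Prop}
    (h : Der D.N D.δ (Set.univ : Set (C × X)) (fun j w => E j (fun i => (w i).1) (fun i => (w i).2)))
    (hE : ∀ j c x, E j c x → x ∈ D.SS j) :
    Der D.N D.δ (Set.univ : Set ((C × X) × X)) (fun j w =>
      D.SwapEv P E j (fun i => (w i).1.1) (fun i => (w i).2) (fun i => (w i).1.2)) := by
  obtain ⟨s, hs⟩ := D.totXY
  obtain ⟨s', hs'⟩ := D.totXZ
  have h1 := D.swap_iter (D.swap_base P h hE) s
  have h2 := D.swapD_not' (D.swap_iter (D.swapD_not h1) s')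
  refine h2.map (fun p => ((p.1, p.2.2), p.2.1)) ?_ (fun j w hw => hw)
  rintro ⟨⟨c, x1⟩, x0⟩ _
  exact ⟨(c, x0, x1), ⟨fun _ => hs _ _, fun _ => hs' _ _⟩, rfl⟩

end GD
namespace GD

def pick {κ : Type*} (τ : Fin 3) (k0 k1 k2 : κ) : κ :=
  if τ = 0 then k0 else if τ = 1 then k1 else k2

lemma pick_self {κ : Type*} (τ : Fin 3) (k : κ) : pick τ k k k = k := by
  unfold pick; split_ifs <;> rfl

lemma blow {J : Type*} {N : J → ℕ} {δ : J → ℝ} (hδ : ∀ j, 0 ≤ δ j)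
    {C X κ : Type*} [Fintype C] [Fintype X] [Fintype κ] [Nonempty κ] [DecidableEq κ] (τ : C → Fin 3)
    {E : ∀ j, (Fin (N j) → C) → (Fin (N j) → X) → Prop}
    (h : Der N δ (Set.univ : Set (C × X)) (fun j w => E j (fun i => (w i).1) (fun i => (w i).2))) :
    Der N δ (Set.univ : Set (C × (κ → X))) (fun j w => ∀ k0 k1 k2,
      E j (fun i => (w i).1) (fun i => (w i).2 (pick (τ (w i).1) k0 k1 k2))) := by
  obtain ⟨e⟩ := ‹Nonempty κ›
  have : Nonempty κ := ⟨e⟩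
  have h1 := Der.copy (κ := κ) hδ h
    (fun p => (p.1, if τ p.1 = 2 then (none : Option X) else some p.2))
  have h2 := Der.copy (κ := κ) hδ h1
    (fun o => ((o e).1, if τ (o e).1 = 1 then (none : Option (κ → C × X)) else some o))
  have h3 := Der.copy (κ := κ) hδ h2
    (fun o => ((o e e).1, if τ (o e e).1 = 0 then (none : Option (κ → κ → C × X)) else some o))
  refine h3.map (fun O => ((O e e e).1, fun k => (O k k k).2)) ?_ ?_
  · rintro ⟨c, l⟩ _
    refine ⟨fun k0 k1 k2 => (c, l (pick (τ c) k0 k1 k2)), ⟨fun k0 => ⟨fun k1 => ⟨fun _ => trivial, ?_⟩, ?_⟩, ?_⟩, ?_⟩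
    · intro k k'
      by_cases hc : τ c = 2
      · simp [hc]
      · have : ∀ a b : κ, pick (τ c) k0 k1 a = pick (τ c) k0 k1 b := by
          intro a b; unfold pick; split_ifs <;> first | rfl | omega
        simp [this k k']
    · intro k k'
      by_cases hc : τ c = 1
      · simp [hc]
      · have : ∀ a b d : κ, pick (τ c) k0 a d = pick (τ c) k0 b d := by
          intro a b d; unfold pick; split_ifs <;> rfl
        simp [this k k']
    · intro k k'
      by_cases hc : τ c = 0
      · simp [hc]
      · have : ∀ a b d d' : κ, pick (τ c) a d d' = pick (τ c) b d d' := by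
          intro a b d d'; unfold pick; rw [if_neg hc, if_neg hc]
        simp [this k k']
    · simp [pick_self]
  · rintro j w ⟨hA, hφ3⟩
    have hφ2 := fun a => (hA a).2
    have hφ1 := fun a b => ((hA a).1 b).2
    have hE := fun a b => ((hA a).1 b).1
    have c1 : ∀ i a b c c', (w i a b c).1 = (w i a b c').1 := fun i a b c c' =>
      (Prod.ext_iff.1 (hφ1 a b i c c')).1
    have c2 : ∀ i a b b', (w i a b e).1 = (w i a b' e).1 := fun i a b c =>
      (Prod.ext_iff.1 (hφ2 a i b c)).1
    have c3 : ∀ i a a', (w i a e e).1 = (w i a' e e).1 := fun i a b =>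
      (Prod.ext_iff.1 (hφ3 i a b)).1
    have hc : ∀ i a b c, (w i a b c).1 = (w i e e e).1 := fun i a b c => by
      rw [c1 i a b c e, c2 i a b e, c3 i a e]
    have d1 : ∀ i a b c c', τ (w i e e e).1 ≠ 2 → (w i a b c).2 = (w i a b c').2 := by
      intro i a b c c' h
      have := (Prod.ext_iff.1 (hφ1 a b i c c')).2
      simpa only [hc i, h, if_false, Option.some.injEq] using this
    have d2 : ∀ i a b b', τ (w i e e e).1 ≠ 1 → w i a b = w i a b' := by
      intro i a b c h
      have := (Prod.ext_iff.1 (hφ2 a i b c)).2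
      simpa only [hc i, h, if_false, Option.some.injEq] using this
    have d3 : ∀ i a a', τ (w i e e e).1 ≠ 0 → w i a = w i a' := by
      intro i a b h
      have := (Prod.ext_iff.1 (hφ3 i a b)).2
      simpa only [hc i, h, if_false, Option.some.injEq] using this
    intro k0 k1 k2
    have := hE k0 k1 k2
    have e1 : (fun i => (w i k0 k1 k2).1) = fun i => (w i e e e).1 := funext fun i => hc i _ _ _
    rw [e1] at this
    have e2 : ∀ i, (w i k0 k1 k2).2 = (w i (pick (τ (w i e e e).1) k0 k1 k2)
        (pick (τ (w i e e e).1) k0 k1 k2) (pick (τ (w i e e e).1) k0 k1 k2)).2 := by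
      intro i
      have h012 : τ (w i e e e).1 = 0 ∨ τ (w i e e e).1 = 1 ∨ τ (w i e e e).1 = 2 := by omega
      rcases h012 with h | h | h
      · have p : pick (τ (w i e e e).1) k0 k1 k2 = k0 := by simp [pick, h]
        rw [p, d2 i k0 k1 k0 (by rw [h]; decide), d1 i k0 k0 k2 k0 (by rw [h]; decide)]
      · have p : pick (τ (w i e e e).1) k0 k1 k2 = k1 := by simp [pick, h]
        rw [p, d3 i k0 k1 (by rw [h]; decide), d1 i k1 k1 k2 k1 (by rw [h]; decide)]
      · have p : pick (τ (w i e e e).1) k0 k1 k2 = k2 := by simp [pick, h]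
        rw [p, d3 i k0 k2 (by rw [h]; decide), d2 i k2 k1 k2 (by rw [h]; decide)]
    rw [show (fun i => (w i k0 k1 k2).2) = _ from funext e2] at this
    exact this

lemma decomp {K A : Type*} [AddCommGroup A] [Nonempty K] (V : K → K → K → A) (a : K → A) (b : K → K → A)
    (a' : K → A) (b' : K → K → A) (h1 : ∀ x y z, V x y z = a x + b y z)
    (h2 : ∀ x y z, V x y z = a' y + b' x z) :
    ∃ u v w : K → A, ∀ x y z, V x y z = u x + v y + w z := by
  obtain ⟨e⟩ := ‹Nonempty K›
  refine ⟨a, a', fun z => b' e z - a e, fun x y z => ?_⟩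
  have h3 : b y z = a' y + b' e z - a e := by
    have := (h1 e y z).symm.trans (h2 e y z)
    rw [← this, add_sub_cancel_left]
  rw [h1, h3]; dsimp only; abel

variable {J X Y Z S A : Type*} [Fintype X] [Fintype Y] [Fintype Z] [Fintype S]
    [AddCommGroup A] (D : GD J X Y Z S A)

abbrev C3 (X : Type*) := (Fin 3 × X) × X

lemma types : Der D.N D.δ (Set.univ : Set (Fin 3 × X)) (fun j w => (fun i => (w i).2) ∈ D.SS j) := by
  have h := D.base.ext D.hδ (Ω' := Fin 3) (fun _ _ => 1/3) (by intros; norm_num) (by intros; simp)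
    (fun _ _ _ => True) 0 ?_
  · refine h.map (fun p => (p.2, p.1)) ?_ (fun j w hw => hw.1)
    rintro ⟨τ, x⟩ _
    exact ⟨(x, τ), ⟨trivial, by norm_num⟩, rfl⟩
  · intro j w _
    rw [pow_zero]
    have : ∑ w' : Fin (D.N j) → Fin 3, ∏ i : Fin (D.N j), (1/3 : ℝ) = 1 := by
      rw [← prod_sum_words (fun (_ : Fin (D.N j)) (_ : Fin 3) => (1/3 : ℝ))]; simp
    simp only [ind_true trivial, one_mul]
    exact this.ge

def Ev1 (j : J) (c : Fin (D.N j) → Fin 3 × X) (x : Fin (D.N j) → X) : Prop :=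
  x ∈ D.SS j ∧ ∀ i, D.f j x i + D.f j (fun i => (c i).2) i =
    D.f j (mix (fun τ : Fin 3 => τ = 0) (fun i => (c i).1) x (fun i => (c i).2)) i +
    D.f j (mix (fun τ : Fin 3 => τ = 0) (fun i => (c i).1) (fun i => (c i).2) x) i

def Ev2 (j : J) (c : Fin (D.N j) → C3 X) (x : Fin (D.N j) → X) : Prop :=
  D.Ev1 j (fun i => (c i).1) x ∧ ∀ i, D.f j x i + D.f j (fun i => (c i).2) i =
    D.f j (mix (fun τ : Fin 3 × X => τ.1 = 1) (fun i => (c i).1) x (fun i => (c i).2)) i +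
    D.f j (mix (fun τ : Fin 3 × X => τ.1 = 1) (fun i => (c i).1) (fun i => (c i).2) x) i

lemma der_ev2 : Der D.N D.δ (Set.univ : Set (C3 X × X))
    (fun j w => D.Ev2 j (fun i => (w i).1) (fun i => (w i).2)) := by
  have h1 := D.swap (fun τ : Fin 3 => τ = 0) (E := fun j _ x => x ∈ D.SS j) D.types
    (fun j c x h => h)
  have h2 : Der D.N D.δ (Set.univ : Set ((Fin 3 × X) × X))
      (fun j w => D.Ev1 j (fun i => (w i).1) (fun i => (w i).2)) := by
    refine h1.map id (by simp) ?_
    rintro j w ⟨a, _, _, _, b⟩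
    exact ⟨a, b⟩
  have h3 := D.swap (fun τ : Fin 3 × X => τ.1 = 1) (E := D.Ev1) h2 (fun j c x h => h.1)
  refine h3.map id (by simp) ?_
  rintro j w ⟨a, _, _, _, b⟩
  exact ⟨a, b⟩

lemma ev2_decomp {κ : Type*} [Nonempty κ] (j : J) (c : Fin (D.N j) → C3 X) (l : Fin (D.N j) → κ → X)
    (h : ∀ k0 k1 k2, D.Ev2 j c (fun i => l i (pick (c i).1.1 k0 k1 k2))) (i : Fin (D.N j)) :
    ∃ u v w : κ → A, ∀ k0 k1 k2,
      D.f j (fun i => l i (pick (c i).1.1 k0 k1 k2)) i = u k0 + v k1 + w k2 := by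
  refine decomp (fun k0 k1 k2 => D.f j (fun i => l i (pick (c i).1.1 k0 k1 k2)) i)
    (fun k0 => D.f j (fun i => if (c i).1.1 = 0 then l i k0 else (c i).1.2) i
      - D.f j (fun i => (c i).1.2) i)
    (fun k1 k2 => D.f j (fun i => if (c i).1.1 = 0 then (c i).1.2 else
      if (c i).1.1 = 1 then l i k1 else l i k2) i)
    (fun k1 => D.f j (fun i => if (c i).1.1 = 1 then l i k1 else (c i).2) i
      - D.f j (fun i => (c i).2) i)
    (fun k0 k2 => D.f j (fun i => if (c i).1.1 = 1 then (c i).2 else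
      if (c i).1.1 = 0 then l i k0 else l i k2) i) ?_ ?_
  · intro k0 k1 k2
    have := (h k0 k1 k2).1.2 i
    rw [eq_sub_of_add_eq this, add_sub_right_comm]
    congr 3
    · congr 1; funext i; unfold mix pick; dsimp only; split_ifs <;> rfl
    · funext i; unfold mix pick; dsimp only; split_ifs <;> rfl
  · intro k0 k1 k2
    have := (h k0 k1 k2).2 i
    rw [eq_sub_of_add_eq this, add_sub_right_comm]
    congr 3
    · congr 1; funext i; unfold mix pick; dsimp only
      by_cases h1 : (c i).1.1 = 1
      · simp [h1]
      · simp only [h1, if_false]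
    · funext i; unfold mix pick; dsimp only
      by_cases h1 : (c i).1.1 = 1
      · simp [h1]
      · simp only [h1, if_false]; split_ifs <;> rfl

variable {B : Type*} [Fintype B] [AddCommGroup B] (mk : (S → A) →+ B)

def A3 : Set ((S → Y) × (S → Z) × B) :=
  {p | ∃ ξ : S → S, p = (fun l => D.yS (ξ l), fun l => D.zS (ξ l), mk (fun l => D.t (ξ l))) ∧
    ((∃ q : X → X, ∀ l, D.xS (ξ l) = q (D.xS l)) ∨ (∃ q : Y → X, ∀ l, D.xS (ξ l) = q (D.yS l))
      ∨ (∃ q : Z → X, ∀ l, D.xS (ξ l) = q (D.zS l)))}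

/-- mixed `g`-word in the quotient -/
def Gm (j : J) (y : Fin (D.N j) → S → Y) (i : Fin (D.N j)) : B :=
  mk (fun l => D.g j (fun i => y i l) i)
def Hm (j : J) (z : Fin (D.N j) → S → Z) (i : Fin (D.N j)) : B :=
  mk (fun l => D.h j (fun i => z i l) i)

lemma der_three [Nonempty X] (hmk : ∀ (u : X → A) (v : Y → A) (w : Z → A),
    mk (fun l => u (D.xS l) + v (D.yS l) + w (D.zS l)) = 0) :
    Der D.N D.δ (D.A3 mk) (fun j w => ∀ i, D.Gm mk j (fun i => (w i).1) i
      + D.Hm mk j (fun i => (w i).2.1) i = (w i).2.2) := by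
  have h1 := blow (κ := X ⊕ (Y ⊕ Z)) D.hδ (fun c : C3 X => c.1.1) D.der_ev2
  have h2 := D.attach h1 (ι := S) (fun l p => p.2 (pick p.1.1.1 (Sum.inl (D.xS l))
    (Sum.inr (Sum.inl (D.yS l))) (Sum.inr (Sum.inr (D.zS l)))))
    (fun j w hw l => (hw _ _ _).1.1)
  refine h2.map (fun p => (fun l => D.yS (p.2 l), fun l => D.zS (p.2 l),
    mk (fun l => D.t (p.2 l)))) ?_ ?_
  · rintro p ⟨ξ, rfl, hq⟩
    obtain ⟨x0⟩ := ‹Nonempty X›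
    rcases hq with ⟨q, hq⟩ | ⟨q, hq⟩ | ⟨q, hq⟩
    · refine ⟨((((0, x0), x0), Sum.elim q (fun _ => x0)), ξ), ⟨trivial, fun l => ?_⟩, rfl⟩
      simp [pick, hq]
    · refine ⟨((((1, x0), x0), Sum.elim (fun _ => x0) (Sum.elim q (fun _ => x0))), ξ),
        ⟨trivial, fun l => ?_⟩, rfl⟩
      simp [pick, hq]
    · refine ⟨((((2, x0), x0), Sum.elim (fun _ => x0) (Sum.elim (fun _ => x0) q)), ξ),
        ⟨trivial, fun l => ?_⟩, rfl⟩
      simp [pick, hq]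
  · rintro j w ⟨hE, hW⟩ i
    obtain ⟨u, v, s, huv⟩ := D.ev2_decomp j (fun i => (w i).1.1) (fun i => (w i).1.2) hE i
    have hf : mk (fun l => D.f j (fun i => D.xS ((w i).2 l)) i) = 0 := by
      rw [← hmk (fun x => u (Sum.inl x)) (fun y => v (Sum.inr (Sum.inl y)))
        (fun z => s (Sum.inr (Sum.inr z)))]
      congr 1
      funext l
      rw [← huv]
      congr 1
      funext i
      exact (hW l).2 i
    unfold Gm Hm
    rw [← map_add]
    rw [← zero_add (mk _), ← hf, ← map_add]
    congr 1
    funext l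
    have := (hW l).1 i
    dsimp only
    rw [← this]
    simp only [Pi.add_apply]
    abel

def compSet {V : Type*} (Q : Set (V × V × B)) : Set (V × V × B) :=
  {p | ∃ v s1 s2, (p.1, v, s1) ∈ Q ∧ (p.2.1, v, s2) ∈ Q ∧ p.2.2 = s1 - s2}

def Q0 : Set ((S → Y) × (S → Y) × B) :=
  {p | ∃ z s1 s2, (p.1, z, s1) ∈ D.A3 mk ∧ (p.2.1, z, s2) ∈ D.A3 mk ∧ p.2.2 = s1 - s2}

def Qs : ℕ → Set ((S → Y) × (S → Y) × B)
  | 0 => D.Q0 mk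
  | s + 1 => compSet (Qs s)

lemma der_q0 [Nonempty X] (hmk : ∀ (u : X → A) (v : Y → A) (w : Z → A),
    mk (fun l => u (D.xS l) + v (D.yS l) + w (D.zS l)) = 0) :
    Der D.N D.δ (D.Q0 mk) (fun j w => ∀ i, D.Gm mk j (fun i => (w i).1) i
      - D.Gm mk j (fun i => (w i).2.1) i = (w i).2.2) := by
  have h1 := Der.copy (κ := Bool) D.hδ (D.der_three mk hmk) (fun p => p.2.1)
  refine h1.map (fun o => ((o false).1, (o true).1, (o false).2.2 - (o true).2.2)) ?_ ?_
  · rintro ⟨a, b, s⟩ ⟨z, s1, s2, h1, h2, h3⟩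
    refine ⟨fun k => if k then (b, z, s2) else (a, z, s1), ⟨?_, ?_⟩, ?_⟩
    · intro k; cases k
      · exact h1
      · exact h2
    · intro k k'; cases k <;> cases k' <;> rfl
    · dsimp only at h3; simp [h3]
  · rintro j w ⟨hE, hz⟩ i
    have a := hE false i
    have b := hE true i
    dsimp only at a b ⊢
    rw [← a, ← b, show (fun i => (w i true).2.1) = fun i => (w i false).2.1 from
      funext fun i => hz i true false]
    abel

lemma der_qs [Nonempty X] (hmk : ∀ (u : X → A) (v : Y → A) (w : Z → A),
    mk (fun l => u (D.xS l) + v (D.yS l) + w (D.zS l)) = 0) (s : ℕ) :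
    Der D.N D.δ (D.Qs mk s) (fun j w => ∀ i, D.Gm mk j (fun i => (w i).1) i
      - D.Gm mk j (fun i => (w i).2.1) i = (w i).2.2) := by
  induction s with
  | zero => exact D.der_q0 mk hmk
  | succ s ih =>
    have h1 := Der.copy (κ := Bool) D.hδ ih (fun p => p.2.1)
    refine h1.map (fun o => ((o false).1, (o true).1, (o false).2.2 - (o true).2.2)) ?_ ?_
    · rintro ⟨a, b, s⟩ ⟨z, s1, s2, h1, h2, h3⟩
      refine ⟨fun k => if k then (b, z, s2) else (a, z, s1), ⟨?_, ?_⟩, ?_⟩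
      · intro k; cases k
        · exact h1
        · exact h2
      · intro k k'; cases k <;> cases k' <;> rfl
      · dsimp only at h3; simp [h3]
    · rintro j w ⟨hE, hz⟩ i
      have a := hE false i
      have b := hE true i
      dsimp only at a b ⊢
      rw [← a, ← b, show (fun i => (w i true).2.1) = fun i => (w i false).2.1 from
        funext fun i => hz i true false]
      abel

lemma qs_y (hmk : ∀ (u : X → A) (v : Y → A) (w : Z → A),
    mk (fun l => u (D.xS l) + v (D.yS l) + w (D.zS l)) = 0) (s : ℕ) (u u' : Y → Y)
    (h : ∀ y, itr D.shareYZ s (u y) (u' y)) :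
    (fun l => u (D.yS l), fun l => u' (D.yS l), (0 : B)) ∈ D.Qs mk s := by
  induction s generalizing u u' with
  | zero =>
    choose a b ha hb hab using h
    have hz : ∀ p : Y → S, mk (fun l => D.t (p (D.yS l))) = 0 := fun p => by
      simpa using hmk (fun _ => 0) (fun y => D.t (p y)) (fun _ => 0)
    refine ⟨fun l => D.zS (a (D.yS l)), 0, 0, ⟨fun l => a (D.yS l), ?_, Or.inr (Or.inl ⟨fun y => D.xS (a y), fun l => rfl⟩)⟩,
      ⟨fun l => b (D.yS l), ?_, Or.inr (Or.inl ⟨fun y => D.xS (b y), fun l => rfl⟩)⟩, by simp⟩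
    · simp only [hz, ha]
    · simp only [hz, hb, hab]
  | succ s ih =>
    choose m h1 h2 using h
    exact ⟨fun l => m (D.yS l), 0, 0, ih u m h1, ih u' m h2, by simp⟩

lemma qs_z (hmk : ∀ (u : X → A) (v : Y → A) (w : Z → A),
    mk (fun l => u (D.xS l) + v (D.yS l) + w (D.zS l)) = 0) (s : ℕ) (u u' : Z → Y)
    (h : ∀ y, itr D.shareYZ s (u y) (u' y)) :
    (fun l => u (D.zS l), fun l => u' (D.zS l), (0 : B)) ∈ D.Qs mk s := by
  induction s generalizing u u' with
  | zero =>
    choose a b ha hb hab using h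
    have hz : ∀ p : Z → S, mk (fun l => D.t (p (D.zS l))) = 0 := fun p => by
      simpa using hmk (fun _ => 0) (fun _ => 0) (fun y => D.t (p y))
    refine ⟨fun l => D.zS (a (D.zS l)), 0, 0, ⟨fun l => a (D.zS l), ?_, Or.inr (Or.inr ⟨fun y => D.xS (a y), fun l => rfl⟩)⟩,
      ⟨fun l => b (D.zS l), ?_, Or.inr (Or.inr ⟨fun y => D.xS (b y), fun l => rfl⟩)⟩, by simp⟩
    · simp only [hz, ha]
    · simp only [hz, hb, hab]
  | succ s ih =>
    choose m h1 h2 using h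
    exact ⟨fun l => m (D.zS l), 0, 0, ih u m h1, ih u' m h2, by simp⟩

lemma qs_t (hmk : ∀ (u : X → A) (v : Y → A) (w : Z → A),
    mk (fun l => u (D.xS l) + v (D.yS l) + w (D.zS l)) = 0) :
    ∃ υ : Z → Y, ∀ s, (fun l => D.yS l, fun l => υ (D.zS l), mk D.t) ∈ D.Qs mk s := by
  choose p hp using D.zsurj
  refine ⟨fun z => D.yS (p z), fun s => ?_⟩
  induction s with
  | zero =>
    have hz : mk (fun l => D.t (p (D.zS l))) = 0 := by
      simpa using hmk (fun _ => 0) (fun _ => 0) (fun y => D.t (p y))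
    refine ⟨D.zS, mk D.t, 0, ⟨id, rfl, Or.inl ⟨id, fun l => rfl⟩⟩,
      ⟨fun l => p (D.zS l), ?_, Or.inr (Or.inr ⟨fun z => D.xS (p z), fun l => rfl⟩)⟩, by simp⟩
    simp only [hz, hp]
  | succ s ih =>
    exact ⟨_, _, 0, ih, D.qs_z mk hmk s (fun z => D.yS (p z)) (fun z => D.yS (p z))
      (fun z => itr_refl D.reflYZ s _), by simp⟩

theorem main [Nonempty X] [Nonempty Y] (hmk : ∀ (u : X → A) (v : Y → A) (w : Z → A),
    mk (fun l => u (D.xS l) + v (D.yS l) + w (D.zS l)) = 0) (ht : mk D.t ≠ 0) :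
    ∃ k : ℕ, ∃ q : ℝ, 0 ≤ q ∧ q < 1 ∧ ∀ j, D.δ j ^ k ≤ q ^ D.N j := by
  obtain ⟨s, hs⟩ := D.totYZ
  obtain ⟨y0⟩ := ‹Nonempty Y›
  obtain ⟨υ, hυ⟩ := D.qs_t mk hmk
  have q1 : (fun l => D.yS l, fun _ => y0, (0 : B)) ∈ D.Qs mk (s + 1) :=
    D.qs_y mk hmk (s + 1) id (fun _ => y0) (fun y => itr_succ D.reflYZ s _ _ (hs _ _))
  have q2 : (fun l => D.yS l, fun _ => y0, mk D.t) ∈ D.Qs mk (s + 1) :=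
    ⟨_, _, 0, hυ s, D.qs_z mk hmk s (fun _ => y0) υ (fun z => hs _ _), by simp⟩
  have h1 := Der.copy (κ := Bool) D.hδ (D.der_qs mk hmk (s + 1)) (fun p => (p.1, p.2.1))
  refine h1.final (fun b => if b then (fun l => D.yS l, fun _ => y0, mk D.t)
    else (fun l => D.yS l, fun _ => y0, (0 : B))) ⟨?_, ?_⟩ ?_
  · intro k; cases k
    · exact q1
    · exact q2
  · intro k k'; cases k <;> cases k' <;> rfl
  · rintro j w ⟨hE, hφ⟩ i hw
    have a := hE false i
    have b := hE true i
    have e1 : (fun i => (w i true).1) = fun i => (w i false).1 :=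
      funext fun i => (Prod.ext_iff.1 (hφ i true false)).1
    have e2 : (fun i => (w i true).2.1) = fun i => (w i false).2.1 :=
      funext fun i => (Prod.ext_iff.1 (hφ i true false)).2
    rw [e1, e2] at b
    have := a.symm.trans b
    dsimp only at this
    rw [hw] at this
    exact ht (by simpa using this.symm)

end GD

lemma conn_of_emb {S U V : Type*} (uS : S → U) (vS : S → V)
    (h : ∀ (α : U → ℤ) (β : V → ℤ), (∀ s, α (uS s) + β (vS s) = 0) → ∀ u u', α u = α u') (a b : U) :
    Relation.ReflTransGen (fun a b => ∃ s s', uS s = a ∧ uS s' = b ∧ vS s = vS s') a b := by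
  set R := Relation.ReflTransGen (fun a b => ∃ s s', uS s = a ∧ uS s' = b ∧ vS s = vS s') with hR
  have := h (fun u => if R a u then 1 else 0) (fun v => if ∃ s, vS s = v ∧ R a (uS s) then -1 else 0) ?_ b a
  · by_contra hb
    rw [if_neg hb, if_pos Relation.ReflTransGen.refl] at this
    exact absurd this (by norm_num)
  · intro s
    by_cases hs : R a (uS s)
    · have h2 : ∃ s', vS s' = vS s ∧ R a (uS s') := ⟨s, rfl, hs⟩
      simp only [if_pos hs, if_pos h2]; norm_num
    · have h2 : ¬ ∃ s', vS s' = vS s ∧ R a (uS s') := by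
        rintro ⟨s', e, hs'⟩
        exact hs (hs'.tail ⟨s', s, rfl, rfl, e⟩)
      simp only [if_neg hs, if_neg h2]; norm_num

lemma surj_of_emb {S U : Type*} [Nonempty S] (uS : S → U)
    (h : ∀ (α : U → ℤ), (∀ s, α (uS s) = 0) → ∀ u u', α u = α u') : Function.Surjective uS := by
  intro u
  by_contra hu
  obtain ⟨s0⟩ := ‹Nonempty S›
  push Not at hu
  have := h (fun v => if v = u then 1 else 0) (fun s => by simp [hu s]) u (uS s0)
  simp [hu s0] at this

lemma rep_core {X Y Z S A : Type*} [Fintype X] [Fintype Y] [Fintype Z] [Fintype S] [Fintype A]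
    [AddCommGroup A] [Nonempty X] [Nonempty Y] (xS : S → X) (yS : S → Y) (zS : S → Z) (t : S → A)
    (m : S → ℝ) (m0 : ∀ s, 0 < m s) (m1 : ∑ s, m s = 1)
    (xsurj : Function.Surjective xS) (ysurj : Function.Surjective yS)
    (zsurj : Function.Surjective zS)
    (cXY : ∀ a b, Relation.ReflTransGen (fun a b => ∃ s s', xS s = a ∧ xS s' = b ∧ yS s = yS s') a b)
    (cXZ : ∀ a b, Relation.ReflTransGen (fun a b => ∃ s s', xS s = a ∧ xS s' = b ∧ zS s = zS s') a b)
    (cYZ : ∀ a b, Relation.ReflTransGen (fun a b => ∃ s s', yS s = a ∧ yS s' = b ∧ zS s = zS s') a b)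
    (hval : ¬ ∃ (u : X → A) (v : Y → A) (w : Z → A), ∀ s, u (xS s) + v (yS s) + w (zS s) = t s) :
    ∃ k : ℕ, ∃ q : ℝ, 0 ≤ q ∧ q < 1 ∧ ∀ (n : ℕ) (f : (Fin n → X) → Fin n → A)
      (g : (Fin n → Y) → Fin n → A) (h : (Fin n → Z) → Fin n → A),
      (mass m (fun w : Fin n → S => ∀ i, f (fun i => xS (w i)) i + g (fun i => yS (w i)) i
        + h (fun i => zS (w i)) i = t (w i)) / 2) ^ k ≤ q ^ n := by
  set pX : X → ℝ := fun x => ∑ s, ind (xS s = x) * m s with hpX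
  have pX0 : ∀ x, 0 < pX x := by
    intro x
    obtain ⟨s, hs⟩ := xsurj x
    refine lt_of_lt_of_le (m0 s) ?_
    have := single_le_sum (f := fun s => ind (xS s = x) * m s)
      (fun i _ => mul_nonneg (ind_nonneg _) (m0 i).le) (mem_univ s)
    simpa only [ind_true hs, one_mul] using this
  set κ : X → S → ℝ := fun x s => ind (xS s = x) * m s / pX x with hκ
  have κ0 : ∀ a b, 0 ≤ κ a b := fun a b =>
    div_nonneg (mul_nonneg (ind_nonneg _) (m0 b).le) (pX0 a).le
  have κ1 : ∀ a, ∑ b, κ a b = 1 := by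
    intro a; simp only [hκ]; rw [← sum_div]; exact div_self (pX0 a).ne'
  have pκ : ∀ s, pX (xS s) * κ (xS s) s = m s := by
    intro s; simp only [hκ]; rw [ind_true trivial, one_mul, mul_div_cancel₀ _ (pX0 _).ne']
  have pX1 : ∑ x, pX x = 1 := by
    simp only [hpX]; rw [sum_comm]; simp_rw [← sum_mul]; simpa [ind] using m1
  let J := Σ n : ℕ, ((Fin n → X) → Fin n → A) × ((Fin n → Y) → Fin n → A) × ((Fin n → Z) → Fin n → A)
  let W : ∀ j : J, (Fin j.1 → S) → Prop := fun j w => ∀ i, j.2.1 (fun i => xS (w i)) i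
    + j.2.2.1 (fun i => yS (w i)) i + j.2.2.2 (fun i => zS (w i)) i = t (w i)
  let δ : J → ℝ := fun j => mass m (W j) / 2
  have hδ : ∀ j, 0 ≤ δ j := fun j => div_nonneg (sum_nonneg fun w _ =>
    mul_nonneg (ind_nonneg _) (prod_nonneg fun i _ => (m0 _).le)) (by norm_num)
  let q : ∀ j : J, (Fin j.1 → X) → ℝ := fun j x =>
    ∑ w : Fin j.1 → S, ind (W j w ∧ ∀ i, xS (w i) = x i) * ∏ i, κ (x i) (w i)
  have q1 : ∀ j x, q j x ≤ 1 := by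
    intro j x
    calc q j x ≤ ∑ w : Fin j.1 → S, ∏ i, κ (x i) (w i) := by
          refine sum_le_sum fun w _ => ?_
          exact mul_le_of_le_one_left (prod_nonneg fun i _ => κ0 _ _) (ind_le_one _)
      _ = 1 := by rw [← prod_sum_words (fun i s => κ (x i) s)]; simp [κ1]
  have hbase : ∀ j : J, δ j ^ 1 ≤ mass pX (fun x : Fin j.1 → X => δ j ≤ q j x) := by
    intro j
    have e : mass m (W j) = ∑ x : Fin j.1 → X, (∏ i, pX (x i)) * q j x := by
      unfold mass
      simp only [q, mul_sum]
      rw [sum_comm]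
      refine sum_congr rfl fun w _ => ?_
      rw [sum_eq_single (fun i => xS (w i))]
      · have : (W j w ∧ ∀ i, xS (w i) = xS (w i)) = W j w := by simp
        rw [this, mul_left_comm, ← prod_mul_distrib]
        simp only [pκ]
      · intro x _ hx
        rw [ind_false, zero_mul, mul_zero]
        rintro ⟨_, h⟩
        exact hx (funext fun i => (h i).symm)
      · simp
    have s1 : ∑ x : Fin j.1 → X, ∏ i, pX (x i) = 1 := by
      rw [← prod_sum_words (fun _ => pX)]; simp [pX1]
    have : mass m (W j) ≤ mass pX (fun x : Fin j.1 → X => δ j ≤ q j x) + δ j := by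
      rw [e]
      calc ∑ x : Fin j.1 → X, (∏ i, pX (x i)) * q j x
          ≤ ∑ x : Fin j.1 → X, (ind (δ j ≤ q j x) * (∏ i, pX (x i)) + (∏ i, pX (x i)) * δ j) := by
            refine sum_le_sum fun x _ => ?_
            have hp : 0 ≤ ∏ i, pX (x i) := prod_nonneg fun i _ => (pX0 _).le
            by_cases hx : δ j ≤ q j x
            · rw [ind_true hx]
              nlinarith [q1 j x, hδ j, mul_nonneg hp (hδ j)]
            · rw [ind_false hx, zero_mul, zero_add]
              exact mul_le_mul_of_nonneg_left (not_le.1 hx).le hp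
        _ = _ := by rw [sum_add_distrib, ← sum_mul, s1, one_mul]; rfl
    have h2 : mass m (W j) = 2 * δ j := by simp only [δ]; ring
    rw [pow_one]; linarith
  let D : GD J X Y Z S A :=
    { N := fun j => j.1, δ := δ, hδ := hδ
      f := fun j => j.2.1, g := fun j => j.2.2.1, h := fun j => j.2.2.2
      xS := xS, yS := yS, zS := zS, t := t
      SS := fun j => {x | δ j ≤ q j x}
      κ := κ, κ0 := κ0, κ1 := κ1
      κp := fun s => by
        simp only [hκ]; rw [ind_true trivial, one_mul]; exact div_pos (m0 s) (pX0 _)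
      hatt := fun j x hx => hx
      base := ⟨pX, fun x => (pX0 x).le, pX1, fun x _ => pX0 x, 1, hbase⟩
      xsurj := xsurj, ysurj := ysurj, zsurj := zsurj, cXY := cXY, cXZ := cXZ, cYZ := cYZ }
  let Nsub : AddSubgroup (S → A) :=
    { carrier := {F | ∃ (u : X → A) (v : Y → A) (w : Z → A), ∀ s, u (xS s) + v (yS s) + w (zS s) = F s}
      zero_mem' := ⟨fun _ => 0, fun _ => 0, fun _ => 0, by simp⟩
      add_mem' := by
        rintro F F' ⟨u, v, w, h⟩ ⟨u', v', w', h'⟩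
        refine ⟨u + u', v + v', w + w', fun s => ?_⟩
        simp only [Pi.add_apply]; rw [← h, ← h']; abel
      neg_mem' := by
        rintro F ⟨u, v, w, h⟩
        refine ⟨-u, -v, -w, fun s => ?_⟩
        simp only [Pi.neg_apply]; rw [← h]; abel }
  let _ : Fintype ((S → A) ⧸ Nsub) := Fintype.ofFinite _
  obtain ⟨k, q, h0, h1, hk⟩ := D.main (QuotientAddGroup.mk' Nsub) (fun u v w =>
    (QuotientAddGroup.eq_zero_iff _).2 ⟨u, v, w, fun s => rfl⟩) (fun h =>
      hval ((QuotientAddGroup.eq_zero_iff _).1 h))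
  exact ⟨k, q, h0, h1, fun n f g h => hk ⟨n, f, g, h⟩⟩

lemma analytic (k : ℕ) (q m0 : ℝ) (hq0 : 0 ≤ q) (hq1 : q < 1) (hm0 : 0 < m0) (hm1 : m0 ≤ 1) :
    ∃ c : ℝ, 0 < c ∧ ∀ n : ℕ, 1 ≤ n → ∀ p : ℝ, 0 ≤ p → (p / 2) ^ k ≤ q ^ n → p ≤ 1 - m0 ^ n →
      p ≤ (2 : ℝ) ^ (-(c * n)) := by
  set s : ℝ := q ^ (((2 * (k + 1) : ℕ) : ℝ)⁻¹) with hs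
  have s0 : 0 ≤ s := Real.rpow_nonneg hq0 _
  have s1 : s < 1 := Real.rpow_lt_one hq0 hq1 (by positivity)
  have sq : s ^ (2 * (k + 1)) = q := Real.rpow_inv_natCast_pow hq0 (by omega)
  obtain ⟨M, hM⟩ := exists_pow_lt_of_lt_one (show (0:ℝ) < 1/2 by norm_num) s1
  set ρ : ℝ := max (1 - m0 ^ (M + 1)) (1/2) with hρ
  have ρ0 : 0 < ρ := lt_of_lt_of_le (by norm_num) (le_max_right _ _)
  have ρ1 : ρ < 1 := max_lt (by have := pow_pos hm0 (M + 1); linarith) (by norm_num)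
  set r : ℝ := ρ ^ (((M + 1 : ℕ) : ℝ)⁻¹) with hr
  have r0 : 0 < r := Real.rpow_pos_of_pos ρ0 _
  have r1 : r < 1 := Real.rpow_lt_one ρ0.le ρ1 (by positivity)
  have rM : r ^ (M + 1) = ρ := Real.rpow_inv_natCast_pow ρ0.le (by omega)
  set b : ℝ := max s r with hb
  have b0 : 0 < b := lt_of_lt_of_le r0 (le_max_right _ _)
  have b1 : b < 1 := max_lt s1 r1
  refine ⟨-Real.logb 2 b, neg_pos.2 (Real.logb_neg (by norm_num) b0 b1), ?_⟩
  intro n hn p hp hpk hpm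
  have e : (2:ℝ) ^ (-(-Real.logb 2 b * n)) = b ^ n := by
    rw [neg_mul, neg_neg, Real.rpow_mul (by norm_num), Real.rpow_logb (by norm_num) (by norm_num) b0,
      Real.rpow_natCast]
  rw [e]
  have hp1 : p ≤ 1 := hpm.trans (by have := pow_pos hm0 n; linarith)
  by_cases hnM : n ≤ M + 1
  · calc p ≤ 1 - m0 ^ n := hpm
      _ ≤ 1 - m0 ^ (M + 1) := by
          have := pow_le_pow_of_le_one hm0.le hm1 hnM; linarith
      _ ≤ ρ := le_max_left _ _
      _ = r ^ (M + 1) := rM.symm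
      _ ≤ r ^ n := pow_le_pow_of_le_one r0.le r1.le hnM
      _ ≤ b ^ n := pow_le_pow_left₀ r0.le (le_max_right _ _) _
  · have h1 : (p / 2) ^ (k + 1) ≤ (s ^ (2 * n)) ^ (k + 1) := by
      calc (p / 2) ^ (k + 1) ≤ (p / 2) ^ k :=
            pow_le_pow_of_le_one (by linarith) (by linarith) (Nat.le_succ k)
        _ ≤ q ^ n := hpk
        _ = (s ^ (2 * n)) ^ (k + 1) := by rw [← sq, ← pow_mul, ← pow_mul]; ring_nf
    have h2 : p / 2 ≤ s ^ (2 * n) :=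
      le_of_pow_le_pow_left₀ (by omega) (pow_nonneg s0 _) h1
    have h3 : s ^ n ≤ 1/2 := (pow_le_pow_of_le_one s0 s1.le (by omega)).trans hM.le
    have h4 : s ^ (2 * n) = s ^ n * s ^ n := by rw [two_mul, pow_add]
    have h5 : s ^ n ≤ b ^ n := pow_le_pow_left₀ s0 (le_max_left _ _) _
    have h6 : 0 ≤ s ^ n := pow_nonneg s0 _
    nlinarith

/-- Parallel repetition with exponential decay for 3-player XOR games
whose question distribution has no `ℤ`-embeddings and whose value is less than `1`. -/
theorem xor_game_parallel_repetition
    {Xt Yt Zt : Type*} [Fintype Xt] [Fintype Yt] [Fintype Zt]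
    [Nonempty Xt] [Nonempty Yt] [Nonempty Zt]
    {A : Type*} [Fintype A] [AddCommGroup A]
    (μ : Xt × Yt × Zt → ℝ)
    (hμ0 : ∀ p, 0 ≤ μ p) (hμ1 : ∑ p, μ p = 1)
    (hemb : ∀ (α : Xt → ℤ) (β : Yt → ℤ) (γ : Zt → ℤ),
      (∀ x y z, 0 < μ (x, y, z) → α x + β y + γ z = 0) →
      ((∀ x x', α x = α x') ∧ (∀ y y', β y = β y') ∧ (∀ z z', γ z = γ z')))
    (t : Xt × Yt × Zt → A)
    (hval : ¬ ∃ (f : Xt → A) (g : Yt → A) (h : Zt → A),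
      ∀ x y z, 0 < μ (x, y, z) → f x + g y + h z = t (x, y, z)) :
    ∃ c : ℝ, 0 < c ∧ ∀ n : ℕ, 1 ≤ n →
      ∀ (f : (Fin n → Xt) → (Fin n → A)) (g : (Fin n → Yt) → (Fin n → A))
        (h : (Fin n → Zt) → (Fin n → A)),
        (∑ x : Fin n → Xt, ∑ y : Fin n → Yt, ∑ z : Fin n → Zt,
          (∏ i, μ (x i, y i, z i)) *
            (if ∀ i, f x i + g y i + h z i = t (x i, y i, z i) then (1 : ℝ) else 0))
        ≤ (2 : ℝ) ^ (-(c * n)) := by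
  classical
  let S := {p : Xt × Yt × Zt // 0 < μ p}
  let xS : S → Xt := fun s => s.1.1
  let yS : S → Yt := fun s => s.1.2.1
  let zS : S → Zt := fun s => s.1.2.2
  let m : S → ℝ := fun s => μ s.1
  have m1 : ∑ s, m s = 1 := by
    rw [← hμ1]
    refine Fintype.sum_of_injective (fun s : S => s.1) Subtype.val_injective _ _ ?_ (fun s => rfl)
    intro p hp
    by_contra hne
    exact hp ⟨⟨p, lt_of_le_of_ne (hμ0 p) (Ne.symm hne)⟩, rfl⟩
  have hSne : Nonempty S := by
    by_contra hS
    rw [not_nonempty_iff] at hS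
    rw [Finset.univ_eq_empty, Finset.sum_empty] at m1
    exact absurd m1 (by norm_num)
  have hx : ∀ (α : Xt → ℤ) (β : Yt → ℤ) (γ : Zt → ℤ),
      (∀ s, α (xS s) + β (yS s) + γ (zS s) = 0) →
      ((∀ x x', α x = α x') ∧ (∀ y y', β y = β y') ∧ (∀ z z', γ z = γ z')) :=
    fun α β γ h => hemb α β γ (fun x y z hp => h ⟨(x, y, z), hp⟩)
  obtain ⟨k, q, hq0, hq1, hk⟩ := rep_core xS yS zS (fun s => t s.1) m (fun s => s.2) m1
    (surj_of_emb xS fun α h => (hx α 0 0 (fun s => by simpa using h s)).1)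
    (surj_of_emb yS fun α h => (hx 0 α 0 (fun s => by simpa using h s)).2.1)
    (surj_of_emb zS fun α h => (hx 0 0 α (fun s => by simpa using h s)).2.2)
    (conn_of_emb xS yS fun α β h => (hx α β 0 (fun s => by simpa using h s)).1)
    (conn_of_emb xS zS fun α β h => (hx α 0 β (fun s => by simpa using h s)).1)
    (conn_of_emb yS zS fun α β h => (hx 0 α β (fun s => by simpa using h s)).2.1)
    (fun ⟨u, v, w, h⟩ => hval ⟨u, v, w, fun x y z hp => h ⟨(x, y, z), hp⟩⟩)
  obtain ⟨s0, hs0⟩ := Finite.exists_min m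
  have hm1 : m s0 ≤ 1 := by
    rw [← m1]; exact single_le_sum (fun s _ => s.2.le) (mem_univ s0)
  obtain ⟨c, hc, hmain⟩ := analytic k q (m s0) hq0 hq1 s0.2 hm1
  refine ⟨c, hc, fun n hn f g h => ?_⟩
  set W : (Fin n → S) → Prop := fun w => ∀ i, f (fun i => xS (w i)) i + g (fun i => yS (w i)) i
        + h (fun i => zS (w i)) i = t (w i).1 with hW
  have hsum : (∑ x : Fin n → Xt, ∑ y : Fin n → Yt, ∑ z : Fin n → Zt,
          (∏ i, μ (x i, y i, z i)) *
            (if ∀ i, f x i + g y i + h z i = t (x i, y i, z i) then (1 : ℝ) else 0)) = mass m W := by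
    unfold mass
    simp_rw [← Fintype.sum_prod_type']
    symm
    refine Fintype.sum_of_injective (fun w : Fin n → S =>
      ((fun i => xS (w i)), (fun i => yS (w i)), (fun i => zS (w i)))) ?_ _ _ ?_ ?_
    · intro w w' he
      simp only [Prod.mk.injEq] at he
      funext i
      exact Subtype.ext (Prod.ext (congrFun he.1 i) (Prod.ext (congrFun he.2.1 i) (congrFun he.2.2 i)))
    · rintro ⟨x, y, z⟩ hp
      have : ∃ i, μ (x i, y i, z i) = 0 := by
        by_contra hne
        push Not at hne
        exact hp ⟨fun i => ⟨(x i, y i, z i), lt_of_le_of_ne (hμ0 _) (hne i).symm⟩, rfl⟩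
      obtain ⟨i, hi⟩ := this
      dsimp only
      rw [prod_eq_zero (mem_univ i) hi, zero_mul]
    · intro w
      rw [mul_comm]
      refine congrArg₂ (· * ·) rfl ?_
      by_cases hw : W w
      · rw [ind_true hw]; exact (if_pos hw).symm
      · rw [ind_false hw]; exact (if_neg hw).symm
  rw [hsum]
  have hs1 : ∑ w : Fin n → S, ∏ i, m (w i) = 1 := by
    rw [← prod_sum_words (fun _ => m)]; simp [m1]
  refine hmain n hn _ ?_ (hk n f g h) ?_
  · exact sum_nonneg fun w _ => mul_nonneg (ind_nonneg _) (prod_nonneg fun i _ => (w i).2.le)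
  · have hlose : ∃ w, ¬ W w := by
      by_contra hall
      push Not at hall
      let i0 : Fin n := ⟨0, hn⟩
      refine hval ⟨fun x => f (fun i => if i = i0 then x else xS s0) i0,
        fun y => g (fun i => if i = i0 then y else yS s0) i0,
        fun z => h (fun i => if i = i0 then z else zS s0) i0, fun x y z hp => ?_⟩
      have := hall (fun i => if i = i0 then ⟨(x, y, z), hp⟩ else s0) i0
      simp only [apply_ite xS, apply_ite yS, apply_ite zS, if_true] at this
      exact this
    obtain ⟨w0, hw0⟩ := hlose
    have h1 : mass m W ≤ ∑ w : Fin n → S, (∏ i, m (w i) - if w = w0 then ∏ i, m (w0 i) else 0) := by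
      refine sum_le_sum fun w _ => ?_
      by_cases hw : w = w0
      · subst hw
        rw [ind_false hw0]; simp
      · rw [if_neg hw, sub_zero]
        exact mul_le_of_le_one_left (prod_nonneg fun i _ => (w i).2.le) (ind_le_one _)
    rw [sum_sub_distrib, hs1] at h1
    have h2 : m s0 ^ n ≤ ∏ i, m (w0 i) := by
      calc m s0 ^ n = ∏ i : Fin n, m s0 := by simp
        _ ≤ _ := prod_le_prod (fun _ _ => s0.2.le) (fun i _ => hs0 _)
    have h3 : ∑ w : Fin n → S, (if w = w0 then ∏ i, m (w0 i) else 0) = ∏ i, m (w0 i) := by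
      rw [sum_eq_single w0 (fun w _ hw => if_neg hw) (by simp)]
      exact if_pos rfl
    linarith
end

section
/- There is an absolute constant c > 0 with the following property. Let Σ, Γ, Φ be finite nonempty alphabets, 𝒜 a finite abelian group, t : Σ×Γ×Φ → 𝒜, δ ∈ (0,1], and let μ, μ', ν be probability distributions on Σ×Γ×Φ with μ = δ·μ' + (1−δ)·ν. Then for every n ≥ 1 and all strategies f : Σ^n → 𝒜^n, g : Γ^n → 𝒜^n, h : Φ^n → 𝒜^n, there exist strategies f', g', h' for the m-fold repeated game with m = ⌈δn/2⌉ such that the winning probability of (f,g,h) with respect to μ^{⊗n} is at most the winning probability of (f',g',h') with respect to (μ')^{⊗m} plus 2^{-c·δ·n}. -/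
open Finset

attribute [local instance] Classical.propDecidable

/-- Sum over triples of tuples equals sum over tuples of triples. -/
lemma rr_sum_triples {ι X Y Z : Type} [Fintype ι] [DecidableEq ι] [Fintype X] [Fintype Y] [Fintype Z]
    (F : (ι → X) → (ι → Y) → (ι → Z) → ℝ) :
    ∑ x : ι → X, ∑ y : ι → Y, ∑ z : ι → Z, F x y z
      = ∑ p : ι → X × Y × Z, F (fun i => (p i).1) (fun i => (p i).2.1) (fun i => (p i).2.2) := by
  let e : (ι → X × Y × Z) ≃ (ι → X) × (ι → Y) × (ι → Z) :=
    { toFun := fun p => (fun i => (p i).1, fun i => (p i).2.1, fun i => (p i).2.2)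
      invFun := fun q i => (q.1 i, q.2.1 i, q.2.2 i)
      left_inv := fun p => rfl
      right_inv := fun q => rfl }
  have h1 := Equiv.sum_comp e (fun q => F q.1 q.2.1 q.2.2)
  have h2 : ∑ x : ι → X, ∑ y : ι → Y, ∑ z : ι → Z, F x y z
      = ∑ q : (ι → X) × (ι → Y) × (ι → Z), F q.1 q.2.1 q.2.2 := by
    rw [Fintype.sum_prod_type]
    refine Finset.sum_congr rfl fun x _ => ?_
    rw [Fintype.sum_prod_type]
  rw [h2, ← h1]
  rfl

/-- Sum over functions split along an equivalence with a sum type. -/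
lemma rr_sum_split {ι α β P : Type} [Fintype ι] [Fintype α] [Fintype β] [Fintype P]
    [DecidableEq ι] [DecidableEq α] [DecidableEq β]
    (s : α ⊕ β ≃ ι) (F : (ι → P) → ℝ) :
    ∑ p : ι → P, F p
      = ∑ b : β → P, ∑ a : α → P, F (fun i => Sum.elim a b (s.symm i)) := by
  let e : (ι → P) ≃ (β → P) × (α → P) :=
    { toFun := fun p => (fun j => p (s (Sum.inr j)), fun j => p (s (Sum.inl j)))
      invFun := fun q i => Sum.elim q.2 q.1 (s.symm i)
      left_inv := fun p => by
        funext i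
        obtain ⟨j, rfl⟩ := s.surjective i
        cases j <;> simp
      right_inv := fun q => by
        ext j <;> simp }
  rw [← Equiv.sum_comp e.symm F, Fintype.sum_prod_type]
  rfl

/-- Product weights sum to one. -/
lemma rr_sum_prod {ι P : Type} [Fintype ι] [DecidableEq ι] [Fintype P] (ρ : ι → P → ℝ)
    (h : ∀ i, ∑ p, ρ i p = 1) : ∑ p : ι → P, ∏ i, ρ i (p i) = 1 := by
  rw [← Fintype.prod_sum]
  simp [h]

/-- Winning probability in the game with coordinate distributions `ρ i`. -/
noncomputable def rrVal {X Y Z A : Type} [Fintype X] [Fintype Y] [Fintype Z] [AddCommGroup A]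
    (t : X × Y × Z → A) {n : ℕ} (ρ : Fin n → X × Y × Z → ℝ)
    (f : (Fin n → X) → Fin n → A) (g : (Fin n → Y) → Fin n → A)
    (h : (Fin n → Z) → Fin n → A) : ℝ :=
  ∑ p : Fin n → X × Y × Z, (∏ i, ρ i (p i)) *
    (if ∀ i, f (fun i => (p i).1) i + g (fun i => (p i).2.1) i + h (fun i => (p i).2.2) i = t (p i)
      then (1 : ℝ) else 0)

lemma rrVal_nonneg {X Y Z A : Type} [Fintype X] [Fintype Y] [Fintype Z] [AddCommGroup A]
    (t : X × Y × Z → A) {n : ℕ} (ρ : Fin n → X × Y × Z → ℝ) (hρ : ∀ i p, 0 ≤ ρ i p)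
    (f : (Fin n → X) → Fin n → A) (g : (Fin n → Y) → Fin n → A)
    (h : (Fin n → Z) → Fin n → A) : 0 ≤ rrVal t ρ f g h := by
  refine Finset.sum_nonneg fun p _ => mul_nonneg (Finset.prod_nonneg fun i _ => hρ i _) ?_
  split_ifs <;> norm_num

lemma rrVal_le_one {X Y Z A : Type} [Fintype X] [Fintype Y] [Fintype Z] [AddCommGroup A]
    (t : X × Y × Z → A) {n : ℕ} (ρ : Fin n → X × Y × Z → ℝ) (hρ : ∀ i p, 0 ≤ ρ i p)
    (hs : ∀ i, ∑ p, ρ i p = 1)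
    (f : (Fin n → X) → Fin n → A) (g : (Fin n → Y) → Fin n → A)
    (h : (Fin n → Z) → Fin n → A) : rrVal t ρ f g h ≤ 1 := by
  rw [← rr_sum_prod ρ hs]
  refine Finset.sum_le_sum fun p _ =>
    mul_le_of_le_one_right (Finset.prod_nonneg fun i _ => hρ i _) ?_
  split_ifs <;> norm_num

/-- Restriction: fixing the coordinates outside `m` of the `μ'`-coordinates. -/
lemma rr_restrict {X Y Z A : Type} [Fintype X] [Fintype Y] [Fintype Z] [AddCommGroup A]
    (t : X × Y × Z → A) {n m k : ℕ} (s : Fin m ⊕ Fin k ≃ Fin n)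
    (ρ : Fin n → X × Y × Z → ℝ) (hρ : ∀ i p, 0 ≤ ρ i p) (hs : ∀ i, ∑ p, ρ i p = 1)
    (μ' : X × Y × Z → ℝ) (hμ : ∀ j, ρ (s (Sum.inl j)) = μ') (V : ℝ)
    (hV : ∀ f g h, rrVal t (fun _ : Fin m => μ') f g h ≤ V)
    (f : (Fin n → X) → Fin n → A) (g : (Fin n → Y) → Fin n → A)
    (h : (Fin n → Z) → Fin n → A) : rrVal t ρ f g h ≤ V := by
  have hμ0 : ∀ j : Fin m, ∀ p, 0 ≤ μ' p := fun j p => by rw [← hμ j]; exact hρ _ _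
  have key : rrVal t ρ f g h ≤ ∑ b : Fin k → X × Y × Z, (∏ j, ρ (s (Sum.inr j)) (b j)) * V := by
    unfold rrVal
    rw [rr_sum_split s]
    refine Finset.sum_le_sum fun b _ => ?_
    have hb : 0 ≤ ∏ j, ρ (s (Sum.inr j)) (b j) := Finset.prod_nonneg fun i _ => hρ _ _
    refine le_trans ?_ (mul_le_mul_of_nonneg_left (hV
      (fun x j => f (fun i => Sum.elim x (fun l => (b l).1) (s.symm i)) (s (Sum.inl j)))
      (fun x j => g (fun i => Sum.elim x (fun l => (b l).2.1) (s.symm i)) (s (Sum.inl j)))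
      (fun x j => h (fun i => Sum.elim x (fun l => (b l).2.2) (s.symm i)) (s (Sum.inl j)))) hb)
    unfold rrVal
    rw [Finset.mul_sum]
    refine Finset.sum_le_sum fun a _ => ?_
    have hprod : ∏ i, ρ i (Sum.elim a b (s.symm i))
        = (∏ j, ρ (s (Sum.inr j)) (b j)) * ∏ j, μ' (a j) := by
      rw [← Equiv.prod_comp s, Fintype.prod_sum_type, mul_comm]
      simp [hμ]
    have h1 : (fun i => (Sum.elim a b (s.symm i)).1)
        = fun i => Sum.elim (fun l => (a l).1) (fun l => (b l).1) (s.symm i) := by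
      funext i; cases s.symm i <;> rfl
    have h2 : (fun i => (Sum.elim a b (s.symm i)).2.1)
        = fun i => Sum.elim (fun l => (a l).2.1) (fun l => (b l).2.1) (s.symm i) := by
      funext i; cases s.symm i <;> rfl
    have h3 : (fun i => (Sum.elim a b (s.symm i)).2.2)
        = fun i => Sum.elim (fun l => (a l).2.2) (fun l => (b l).2.2) (s.symm i) := by
      funext i; cases s.symm i <;> rfl
    rw [hprod, mul_assoc, h1, h2, h3]
    refine mul_le_mul_of_nonneg_left (mul_le_mul_of_nonneg_left ?_
      (Finset.prod_nonneg fun j _ => hμ0 j _)) hb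
    by_cases hw : ∀ i, f (fun i => Sum.elim (fun l => (a l).1) (fun l => (b l).1) (s.symm i)) i
        + g (fun i => Sum.elim (fun l => (a l).2.1) (fun l => (b l).2.1) (s.symm i)) i
        + h (fun i => Sum.elim (fun l => (a l).2.2) (fun l => (b l).2.2) (s.symm i)) i
        = t (Sum.elim a b (s.symm i))
    · rw [if_pos hw, if_pos]
      intro j
      have := hw (s (Sum.inl j))
      simpa using this
    · rw [if_neg hw]
      split_ifs <;> norm_num
  rw [← Finset.sum_mul, rr_sum_prod (fun j => ρ (s (Sum.inr j))) (fun j => hs _), one_mul] at key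
  exact key

/-- Expansion of the mixture over random subsets. -/
lemma rr_expand {X Y Z A : Type} [Fintype X] [Fintype Y] [Fintype Z] [AddCommGroup A]
    (t : X × Y × Z → A) {n : ℕ} (δ : ℝ) (μ μ' ν : X × Y × Z → ℝ)
    (hm : ∀ p, μ p = δ * μ' p + (1 - δ) * ν p)
    (f : (Fin n → X) → Fin n → A) (g : (Fin n → Y) → Fin n → A)
    (h : (Fin n → Z) → Fin n → A) :
    rrVal t (fun _ => μ) f g h = ∑ S : Finset (Fin n), δ ^ #S * (1 - δ) ^ (n - #S) *
      rrVal t (fun i => if i ∈ S then μ' else ν) f g h := by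
  unfold rrVal
  simp_rw [Finset.mul_sum]
  rw [Finset.sum_comm]
  refine Finset.sum_congr rfl fun p _ => ?_
  simp_rw [← mul_assoc]
  rw [← Finset.sum_mul]
  congr 1
  simp_rw [hm]
  rw [Finset.prod_add, Finset.powerset_univ]
  refine Finset.sum_congr rfl fun S _ => ?_
  rw [Finset.prod_mul_distrib, Finset.prod_mul_distrib, Finset.prod_const, Finset.prod_const,
    Finset.card_sdiff_of_subset (Finset.subset_univ S), Finset.card_univ, Fintype.card_fin,
    ← Finset.prod_sdiff (Finset.subset_univ S)]
  have e1 : ∏ x ∈ univ \ S, (if x ∈ S then μ' else ν) (p x) = ∏ x ∈ univ \ S, ν (p x) :=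
    Finset.prod_congr rfl fun x hx => by
      rw [if_neg (Finset.mem_sdiff.1 hx).2]
  have e2 : ∏ x ∈ S, (if x ∈ S then μ' else ν) (p x) = ∏ x ∈ S, μ' (p x) :=
    Finset.prod_congr rfl fun x hx => by rw [if_pos hx]
  rw [e1, e2]
  ring

/-- Random restriction: if `μ = δ·μ' + (1−δ)·ν`, then every strategy for
the `n`-fold game over `μ` yields a strategy for the `⌈δn/2⌉`-fold game over `μ'` whose
winning probability is smaller by at most `2^{-cδn}`. -/
theorem random_restriction_lemma :
    ∃ c : ℝ, 0 < c ∧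
      ∀ (Xt Yt Zt : Type) [Fintype Xt] [Fintype Yt] [Fintype Zt]
        [Nonempty Xt] [Nonempty Yt] [Nonempty Zt]
        (A : Type) [Fintype A] [AddCommGroup A]
        (t : Xt × Yt × Zt → A) (δ : ℝ), 0 < δ → δ ≤ 1 →
      ∀ (μ μ' ν : Xt × Yt × Zt → ℝ),
        (∀ p, 0 ≤ μ p) → (∑ p, μ p = 1) →
        (∀ p, 0 ≤ μ' p) → (∑ p, μ' p = 1) →
        (∀ p, 0 ≤ ν p) → (∑ p, ν p = 1) →
        (∀ p, μ p = δ * μ' p + (1 - δ) * ν p) →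
      ∀ (n : ℕ), 1 ≤ n →
      ∀ (f : (Fin n → Xt) → Fin n → A) (g : (Fin n → Yt) → Fin n → A)
        (h : (Fin n → Zt) → Fin n → A),
      ∃ (f' : (Fin (Nat.ceil (δ * n / 2)) → Xt) → Fin (Nat.ceil (δ * n / 2)) → A)
        (g' : (Fin (Nat.ceil (δ * n / 2)) → Yt) → Fin (Nat.ceil (δ * n / 2)) → A)
        (h' : (Fin (Nat.ceil (δ * n / 2)) → Zt) → Fin (Nat.ceil (δ * n / 2)) → A),
        (∑ x : Fin n → Xt, ∑ y : Fin n → Yt, ∑ z : Fin n → Zt,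
          (∏ i, μ (x i, y i, z i)) *
            (if ∀ i, f x i + g y i + h z i = t (x i, y i, z i) then (1 : ℝ) else 0))
        ≤ (∑ x : Fin (Nat.ceil (δ * n / 2)) → Xt, ∑ y : Fin (Nat.ceil (δ * n / 2)) → Yt,
            ∑ z : Fin (Nat.ceil (δ * n / 2)) → Zt,
            (∏ i, μ' (x i, y i, z i)) *
              (if ∀ i, f' x i + g' y i + h' z i = t (x i, y i, z i) then (1 : ℝ) else 0))
          + (2 : ℝ) ^ (-(c * δ * n)) := by
  have hlog : Real.log 2 < 1 := by have := Real.log_two_lt_d9; linarith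
  have hlog0 : 0 < Real.log 2 := Real.log_pos (by norm_num)
  refine ⟨(1 - Real.log 2) / (2 * Real.log 2), by apply div_pos <;> linarith, ?_⟩
  intro X Y Z _ _ _ _ _ _ A _ _ t δ hδ0 hδ1 μ μ' ν hμ0 hμs hμ'0 hμ's hν0 hνs hmix n hn f g h
  generalize hmdef : Nat.ceil (δ * n / 2) = m
  obtain ⟨⟨f', g', h'⟩, hmax⟩ := Finite.exists_max
    (fun q : ((Fin m → X) → Fin m → A) × ((Fin m → Y) → Fin m → A) × ((Fin m → Z) → Fin m → A) =>
      rrVal t (fun _ => μ') q.1 q.2.1 q.2.2)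
  refine ⟨f', g', h', ?_⟩
  have hL := rr_sum_triples (fun (x : Fin n → X) (y : Fin n → Y) (z : Fin n → Z) =>
    (∏ i, μ (x i, y i, z i)) *
      (if ∀ i, f x i + g y i + h z i = t (x i, y i, z i) then (1 : ℝ) else 0))
  have hR := rr_sum_triples (fun (x : Fin m → X) (y : Fin m → Y) (z : Fin m → Z) =>
    (∏ i, μ' (x i, y i, z i)) *
      (if ∀ i, f' x i + g' y i + h' z i = t (x i, y i, z i) then (1 : ℝ) else 0))
  rw [hL, hR]
  change rrVal t (fun _ => μ) f g h ≤ rrVal t (fun _ => μ') f' g' h' + _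
  set V := rrVal t (fun _ => μ') f' g' h' with hVdef
  have hV0 : 0 ≤ V := rrVal_nonneg t _ (fun _ => hμ'0) _ _ _
  have hVmax : ∀ f g h, rrVal t (fun _ : Fin m => μ') f g h ≤ V :=
    fun f g h => hmax (f, g, h)
  rw [rr_expand t δ μ μ' ν hmix]
  have h1δ : 0 ≤ 1 - δ := by linarith
  have hS : ∀ S : Finset (Fin n), rrVal t (fun i => if i ∈ S then μ' else ν) f g h
      ≤ V + (2 : ℝ) ^ (δ * n / 2) * (1 / 2 : ℝ) ^ #S := by
    intro S
    have hρ0 : ∀ i p, 0 ≤ (fun i => if i ∈ S then μ' else ν) i p := by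
      intro i p
      by_cases hi : i ∈ S <;> simp [hi, hμ'0, hν0]
    have hρs : ∀ i, ∑ p, (fun i => if i ∈ S then μ' else ν) i p = 1 := by
      intro i
      by_cases hi : i ∈ S <;> simp [hi, hμ's, hνs]
    have hpos : 0 ≤ (2 : ℝ) ^ (δ * n / 2) * (1 / 2 : ℝ) ^ #S := by positivity
    by_cases hc : m ≤ #S
    · obtain ⟨T, hTS, hT⟩ := Finset.exists_subset_card_eq hc
      have := rr_restrict t (finSumEquivOfFinset hT (rfl : #Tᶜ = #Tᶜ))
        (fun i => if i ∈ S then μ' else ν) hρ0 hρs μ'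
        (fun j => by
          have : (finSumEquivOfFinset hT (rfl : #Tᶜ = #Tᶜ)) (Sum.inl j) ∈ S := by
            rw [finSumEquivOfFinset_inl]
            exact hTS (Finset.orderEmbOfFin_mem T hT j)
          simp only [this, if_true]) V hVmax f g h
      linarith
    · have hc' : (#S : ℝ) < δ * n / 2 := by
        rw [← hmdef] at hc
        exact Nat.lt_ceil.1 (not_le.1 hc)
      have h1 := rrVal_le_one t _ hρ0 hρs f g h
      have h2 : (1 : ℝ) ≤ (2 : ℝ) ^ (δ * n / 2) * (1 / 2 : ℝ) ^ #S := by
        rw [one_div, inv_pow, ← Real.rpow_natCast, ← div_eq_mul_inv,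
          one_le_div (by positivity)]
        exact Real.rpow_le_rpow_of_exponent_le (by norm_num) hc'.le
      linarith
  have hw1 : ∑ S : Finset (Fin n), δ ^ #S * (1 - δ) ^ (n - #S) = 1 := by
    have := Fintype.sum_pow_mul_eq_add_pow (Fin n) δ (1 - δ)
    simpa using this
  have hw2 : ∑ S : Finset (Fin n), δ ^ #S * (1 - δ) ^ (n - #S) * (1 / 2 : ℝ) ^ #S
      = (1 - δ / 2) ^ n := by
    have := Fintype.sum_pow_mul_eq_add_pow (Fin n) (δ / 2) (1 - δ)
    rw [Fintype.card_fin] at this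
    rw [show (1 - δ / 2) = δ / 2 + (1 - δ) by ring, ← this]
    refine Finset.sum_congr rfl fun S _ => ?_
    rw [div_eq_mul_one_div δ 2, mul_pow]
    ring
  calc _ ≤ ∑ S : Finset (Fin n), δ ^ #S * (1 - δ) ^ (n - #S) *
        (V + (2 : ℝ) ^ (δ * n / 2) * (1 / 2 : ℝ) ^ #S) :=
        Finset.sum_le_sum fun S _ => mul_le_mul_of_nonneg_left (hS S) (by positivity)
    _ = (∑ S : Finset (Fin n), δ ^ #S * (1 - δ) ^ (n - #S)) * V + (2 : ℝ) ^ (δ * n / 2) *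
        ∑ S : Finset (Fin n), δ ^ #S * (1 - δ) ^ (n - #S) * (1 / 2 : ℝ) ^ #S := by
        rw [Finset.sum_mul, Finset.mul_sum, ← Finset.sum_add_distrib]
        exact Finset.sum_congr rfl fun S _ => by ring
    _ = V + (2 : ℝ) ^ (δ * n / 2) * (1 - δ / 2) ^ n := by rw [hw1, hw2, one_mul]
    _ ≤ _ := by
        have hexp : (1 - δ / 2) ^ n ≤ Real.exp (-(δ * n / 2)) := by
          have h1 : 1 - δ / 2 ≤ Real.exp (-(δ / 2)) := by
            have := Real.add_one_le_exp (-(δ / 2))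
            linarith
          calc (1 - δ / 2) ^ n ≤ Real.exp (-(δ / 2)) ^ n :=
                pow_le_pow_left₀ (by linarith) h1 n
            _ = _ := by
                rw [← Real.exp_nat_mul]
                congr 1
                ring
        have : (2 : ℝ) ^ (-((1 - Real.log 2) / (2 * Real.log 2) * δ * n))
            = (2 : ℝ) ^ (δ * n / 2) * Real.exp (-(δ * n / 2)) := by
          rw [Real.rpow_def_of_pos (by norm_num), Real.rpow_def_of_pos (by norm_num),
            ← Real.exp_add]
          congr 1
          field_simp
          ring
        rw [this]
        have := mul_le_mul_of_nonneg_left hexp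
          (by positivity : (0 : ℝ) ≤ (2 : ℝ) ^ (δ * n / 2))
        linarith
end

section
/- Let p be a prime, k ≥ 1 an integer, 𝒜 a finite abelian group, and t : 𝒜³ → ℤ_{p^k}. Call an integer N ≥ 1 admissible if there exist functions a, b, c : 𝒜 → ℤ_{p^k·N} such that a(x) + b(y) + c(z) = N·t(x,y,z) in ℤ_{p^k·N} for all x, y, z ∈ 𝒜 with x + y + z = 0, where N·t(x,y,z) denotes the image of t(x,y,z) under the well-defined multiplication-by-N map from ℤ_{p^k} to ℤ_{p^k·N}. Suppose N > 1 is admissible and no integer N' with 1 ≤ N' < N is admissible. Then there is a constant c > 0 such that for every n ≥ 1 and all functions f, g, h : 𝒜^n → ℤ_{p^k}^n, the probability, over (x, y, z) chosen uniformly from { (x,y,z) ∈ (𝒜^n)³ : x + y + z = 0 }, that f(x)_i + g(y)_i + h(z)_i = t(x_i, y_i, z_i) in ℤ_{p^k} for every i = 1, …, n, is at most 2^{-c·n}. -/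
open Finset

attribute [local instance] Classical.propDecidable

/-- `N` is admissible for the target `t : 𝒜³ → ℤ_{p^k}` if there exist
`a, b, c : 𝒜 → ℤ_{p^k N}` with `a(x) + b(y) + c(z) = N·t(x,y,z)` in `ℤ_{p^k N}`
whenever `x + y + z = 0`. -/
def Admissible (p k : ℕ) {A : Type*} [AddCommGroup A]
    (t : A × A × A → ZMod (p ^ k)) (N : ℕ) : Prop :=
  ∃ (a b c : A → ZMod (p ^ k * N)),
    ∀ x y z : A, x + y + z = 0 →
      a x + b y + c z = (N : ZMod (p ^ k * N)) * ((t (x, y, z)).val : ZMod (p ^ k * N))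

lemma bsg_graph {V : Type*} [Fintype V] (E : V → V → Prop) (ε : ℝ) (hε : 0 < ε)
    (hcard : ε * (Fintype.card V : ℝ) ^ 2 ≤ ∑ l : V, ((univ.filter fun m => E m l).card : ℝ)) :
    ∃ S : Finset V, ε * (Fintype.card V : ℝ) / 4 ≤ S.card ∧ ∀ m ∈ S, ∀ m' ∈ S,
      ∃ Q : Finset (V × V × V), ε ^ 5 * (Fintype.card V : ℝ) ^ 3 / 1024 ≤ Q.card ∧
        ∀ q ∈ Q, E m q.2.1 ∧ E q.1 q.2.1 ∧ E q.1 q.2.2 ∧ E m' q.2.2 := by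
  rcases isEmpty_or_nonempty V with hV | hV
  · refine ⟨∅, by simp, by simp⟩
  set v : ℝ := (Fintype.card V : ℝ) with hv
  have hv0 : 0 < v := by rw [hv]; exact_mod_cast Fintype.card_pos
  let Nb : V → Finset V := fun l => univ.filter fun m => E m l
  let cod : V → V → Finset V := fun m m' => univ.filter fun l => E m l ∧ E m' l
  let bad : V → V → Prop := fun m m' => ((cod m m').card : ℝ) < ε ^ 2 / 16 * v
  have hcodsymm : ∀ m m', cod m m' = cod m' m := by
    intro m m'; ext l; simp [cod, and_comm]
  let B : V → Finset (V × V) := fun l => ((Nb l) ×ˢ (Nb l)).filter fun q => bad q.1 q.2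
  -- sum of squares
  have hsq : ε ^ 2 * v ^ 3 ≤ ∑ l : V, ((Nb l).card : ℝ) ^ 2 := by
    have h1 := sq_sum_le_card_mul_sum_sq (s := (univ : Finset V)) (f := fun l => ((Nb l).card : ℝ))
    rw [card_univ] at h1
    have h2 : (ε * v ^ 2) ^ 2 ≤ (∑ l : V, ((Nb l).card : ℝ)) ^ 2 := by
      gcongr
    have h3 : v * (ε ^ 2 * v ^ 3) ≤ v * ∑ l : V, ((Nb l).card : ℝ) ^ 2 := by
      calc v * (ε ^ 2 * v ^ 3) = (ε * v ^ 2) ^ 2 := by ring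
        _ ≤ _ := h2.trans h1
    exact le_of_mul_le_mul_left h3 hv0
  -- total bad
  have hbad : ∑ l : V, ((B l).card : ℝ) ≤ ε ^ 2 / 16 * v ^ 3 := by
    have h1 : ∑ l : V, (B l).card =
        ∑ q ∈ (univ : Finset (V × V)).filter (fun q => bad q.1 q.2), (cod q.1 q.2).card := by
      have := sum_card_bipartiteAbove_eq_sum_card_bipartiteBelow (s := (univ : Finset V))
        (t := (univ : Finset (V × V)).filter (fun q => bad q.1 q.2))
        (fun l q => E q.1 l ∧ E q.2 l)
      convert this using 2 with l _
      · congr 1; ext q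
        simp [B, Nb, bipartiteAbove]; tauto
      · rfl
    have h2 : (∑ l : V, ((B l).card : ℝ)) =
        ∑ q ∈ (univ : Finset (V × V)).filter (fun q => bad q.1 q.2), ((cod q.1 q.2).card : ℝ) := by
      exact_mod_cast h1
    rw [h2]
    calc _ ≤ ∑ q ∈ (univ : Finset (V × V)).filter (fun q => bad q.1 q.2), ε ^ 2 / 16 * v := by
            apply sum_le_sum; intro q hq; exact (mem_filter.1 hq).2.le
      _ ≤ ∑ q : V × V, ε ^ 2 / 16 * v := by
            apply sum_le_sum_of_subset_of_nonneg (filter_subset _ _)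
            intros; positivity
      _ = _ := by simp [← hv]; ring
  obtain ⟨l, hl⟩ : ∃ l : V, ε ^ 2 * v ^ 2 / 2 ≤ ((Nb l).card : ℝ) ^ 2 - 8 * (B l).card := by
    by_contra! hcon
    have h1 : ∑ l : V, (((Nb l).card : ℝ) ^ 2 - 8 * (B l).card) < ∑ l : V, ε ^ 2 * v ^ 2 / 2 :=
      sum_lt_sum_of_nonempty univ_nonempty (fun l _ => hcon l)
    rw [sum_sub_distrib, ← mul_sum] at h1
    simp [← hv] at h1
    nlinarith
  set s : ℝ := ((Nb l).card : ℝ) with hs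
  have hs0 : 0 ≤ s := by positivity
  have hsl : ε * v / 2 ≤ s := by
    apply le_of_sq_le_sq _ hs0
    have : (0:ℝ) ≤ (B l).card := by positivity
    nlinarith [sq_nonneg (ε * v)]
  have hspos : 0 < s := lt_of_lt_of_le (by positivity) hsl
  have hBl : 8 * ((B l).card : ℝ) ≤ s ^ 2 := by nlinarith [sq_nonneg (ε * v)]
  let bp : V → Finset V := fun m => (Nb l).filter fun m' => bad m m'
  let S := (Nb l).filter fun m => ((bp m).card : ℝ) ≤ s / 4
  have hBsum : ((B l).card : ℝ) = ∑ m ∈ Nb l, ((bp m).card : ℝ) := by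
    have : (B l).card = ∑ m ∈ Nb l, (bp m).card := by
      simp only [B, card_filter, sum_product, bp]
    exact_mod_cast this
  have hS : s / 2 ≤ S.card := by
    have hsplit : (S.card : ℝ) + ((Nb l).filter fun m => ¬ ((bp m).card : ℝ) ≤ s / 4).card = s := by
      rw [hs]; exact_mod_cast card_filter_add_card_filter_not (s := Nb l) (fun m => ((bp m).card : ℝ) ≤ s / 4)
    have h2 : (((Nb l).filter fun m => ¬ ((bp m).card : ℝ) ≤ s / 4).card : ℝ) * (s / 4) ≤ (B l).card := by
      rw [hBsum, ← nsmul_eq_mul, ← sum_const]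
      calc _ ≤ ∑ m ∈ (Nb l).filter (fun m => ¬ ((bp m).card : ℝ) ≤ s / 4), ((bp m).card : ℝ) := by
            apply sum_le_sum; intro m hm; exact (not_le.1 (mem_filter.1 hm).2).le
        _ ≤ _ := by
            apply sum_le_sum_of_subset_of_nonneg (filter_subset _ _)
            intros; positivity
    nlinarith
  refine ⟨S, by linarith, ?_⟩
  intro m hm m' hm'
  obtain ⟨hm1, hm2⟩ := mem_filter.1 hm
  obtain ⟨hm1', hm2'⟩ := mem_filter.1 hm'
  let W := (Nb l) \ (bp m ∪ bp m')
  have hW : s / 2 ≤ W.card := by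
    have h1 : (Nb l).card ≤ W.card + (bp m ∪ bp m').card := by
      have := le_card_sdiff (bp m ∪ bp m') (Nb l)
      simp only [W]; omega
    have h2 := card_union_le (bp m) (bp m')
    have h3 : s ≤ W.card + ((bp m).card + (bp m').card) := by rw [hs]; exact_mod_cast h1.trans (by omega)
    linarith
  let Q : Finset (V × V × V) := univ.filter fun q => q.1 ∈ W ∧ q.2.1 ∈ cod m q.1 ∧ q.2.2 ∈ cod m' q.1
  have hQ : (Q.card : ℝ) = ∑ w ∈ W, ((cod m w).card : ℝ) * ((cod m' w).card : ℝ) := by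
    have hd : (W : Set V).PairwiseDisjoint
        (fun w => ({w} : Finset V) ×ˢ ((cod m w) ×ˢ (cod m' w))) := by
      intro a _ b _ hab
      simp only [Function.onFun, disjoint_left]
      rintro ⟨x, y, z⟩ h1 h2
      simp only [mem_product, mem_singleton] at h1 h2
      exact hab (h1.1.symm.trans h2.1)
    have : Q = W.disjiUnion (fun w => ({w} : Finset V) ×ˢ ((cod m w) ×ˢ (cod m' w))) hd := by
      ext ⟨x, y, z⟩
      simp [Q]
    rw [this, card_disjiUnion]
    simp
  refine ⟨Q, ?_, ?_⟩
  · rw [hQ]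
    have : ∑ w ∈ W, (ε ^ 2 / 16 * v) * (ε ^ 2 / 16 * v) ≤ ∑ w ∈ W, ((cod m w).card : ℝ) * ((cod m' w).card : ℝ) := by
      apply sum_le_sum
      intro w hw
      simp only [W, mem_sdiff, mem_union, not_or, bp, mem_filter, not_and] at hw
      obtain ⟨hw0, hw1, hw2⟩ := hw
      have h1 := not_lt.1 (hw1 hw0)
      have h2 := not_lt.1 (hw2 hw0)
      gcongr
    refine le_trans ?_ this
    rw [sum_const, nsmul_eq_mul]
    have : ε * v / 4 ≤ W.card := by linarith
    calc ε ^ 5 * v ^ 3 / 1024 = (ε * v / 4) * (ε ^ 2 / 16 * v * (ε ^ 2 / 16 * v)) := by ring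
      _ ≤ _ := by gcongr
  · rintro ⟨w, x, y⟩ hq
    simp only [Q, cod, mem_filter, mem_univ, true_and] at hq
    exact ⟨hq.2.1.1, hq.2.1.2, hq.2.2.2, hq.2.2.1⟩

open scoped Pointwise in
lemma bsg_add {V Z : Type*} [Fintype V] [AddCommGroup V] [AddCommGroup Z] (F G H : V → Z) (ε : ℝ) (hε : 0 < ε)
    (hcard : ε * (Fintype.card V : ℝ) ^ 2 ≤
      ((univ.filter fun q : V × V => F q.1 + G q.2 + H (-q.1 - q.2) = 0).card : ℝ)) :
    ∃ S : Finset V, ε * (Fintype.card V : ℝ) / 4 ≤ S.card ∧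
      ((S.image (fun m => (m, F m)) - S.image (fun m => (m, F m))).card : ℝ)
        * (ε ^ 5 * (Fintype.card V : ℝ) ^ 3 / 1024) ≤ (Fintype.card V : ℝ) ^ 4 := by
  obtain ⟨S, hS, hQ⟩ := bsg_graph (V := V) (fun m l => F m + G l + H (-m - l) = 0) ε hε (by
    refine hcard.trans (le_of_eq ?_)
    have : (univ.filter fun q : V × V => F q.1 + G q.2 + H (-q.1 - q.2) = 0).card =
      ∑ l : V, (univ.filter fun m => F m + G l + H (-m - l) = 0).card := by
      simp only [card_filter]
      rw [← univ_product_univ, sum_product_right]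
    exact_mod_cast this)
  refine ⟨S, hS, ?_⟩
  set P : V → V × Z := fun m => (m, F m)
  set D := S.image P - S.image P
  let U : V → V × Z := fun w => (w, H w)
  let val : V × V × V × V → V × Z := fun q => - U q.1 + U q.2.1 - U q.2.2.1 + U q.2.2.2
  have key := card_mul_le_card_mul (s := D) (t := (univ : Finset (V × V × V × V)))
    (fun d q => val q = d) (m := ⌈ε ^ 5 * (Fintype.card V : ℝ) ^ 3 / 1024⌉₊) (n := 1) ?_ ?_
  · rw [card_univ] at key
    simp only [Fintype.card_prod, mul_one] at key
    have k2 : (D.card : ℝ) * (⌈ε ^ 5 * (Fintype.card V : ℝ) ^ 3 / 1024⌉₊ : ℝ) ≤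
      (Fintype.card V : ℝ) * (Fintype.card V * (Fintype.card V * Fintype.card V)) := by exact_mod_cast key
    calc _ ≤ (D.card : ℝ) * (⌈ε ^ 5 * (Fintype.card V : ℝ) ^ 3 / 1024⌉₊ : ℝ) := by
          gcongr; exact Nat.le_ceil _
      _ ≤ _ := k2
      _ = _ := by ring
  · intro d hd
    simp only [D, mem_sub, mem_image] at hd
    obtain ⟨_, ⟨m, hm, rfl⟩, _, ⟨m', hm', rfl⟩, rfl⟩ := hd
    obtain ⟨Q, hQc, hQE⟩ := hQ m hm m' hm'
    refine (Nat.ceil_le.2 hQc).trans ?_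
    refine card_le_card_of_injOn
      (fun q => (-m - q.2.1, -q.1 - q.2.1, -q.1 - q.2.2, -m' - q.2.2)) ?_ ?_
    · intro q hq
      obtain ⟨h1, h2, h3, h4⟩ := hQE q hq
      simp only [bipartiteAbove, coe_filter, mem_univ, true_and, Set.mem_ofPred_eq, val, U, P]
      ext
      · simp; abel
      · simp only [Prod.snd_add, Prod.snd_sub, Prod.snd_neg]
        rw [eq_neg_of_add_eq_zero_right h1, eq_neg_of_add_eq_zero_right h2,
          eq_neg_of_add_eq_zero_right h3, eq_neg_of_add_eq_zero_right h4]
        abel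
    · rintro ⟨a, b, c⟩ _ ⟨a', b', c'⟩ _ h
      simp only [Prod.mk.injEq] at h
      obtain ⟨h1, h2, h3, h4⟩ := h
      have hb := sub_right_injective h1
      have hc := sub_right_injective h4
      subst hb hc
      simpa using h2
  · intro q _
    rw [card_le_one]
    intro a ha b hb
    simp only [bipartiteBelow, mem_filter] at ha hb
    exact ha.2.symm.trans hb.2

open scoped Pointwise in
lemma growth {V Z : Type*} [Fintype V] [AddCommGroup V] [AddCommGroup Z] (e R : ℕ)
    (hV : ∀ m : V, e • m = 0) (F G H : V → Z)
    (hR : ∀ m : V, (univ.filter fun m' => e • F m' = e • F m).card ≤ R) (ε : ℝ) (hε : 0 < ε)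
    (hcard : ε * (Fintype.card V : ℝ) ^ 2 ≤
      ((univ.filter fun q : V × V => F q.1 + G q.2 + H (-q.1 - q.2) = 0).card : ℝ)) :
    ε ^ (6 * e + 7) * Fintype.card V ≤ (4 * 4096 ^ (e + 1)) * R := by
  obtain ⟨S, hS, hD⟩ := bsg_add F G H ε hε hcard
  set v : ℝ := (Fintype.card V : ℝ) with hv
  have hv0 : 0 < v := by rw [hv]; exact_mod_cast Fintype.card_pos
  set P : V → V × Z := fun m => (m, F m) with hP
  have hPinj : Function.Injective P := fun a b h => congrArg Prod.fst h
  set B := S.image P with hB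
  have hBc : B.card = S.card := card_image_of_injective _ hPinj
  have hSpos : (0 : ℝ) < S.card := lt_of_lt_of_le (by positivity) hS
  have hBne : B.Nonempty := by
    rw [← card_pos, hBc]; exact_mod_cast hSpos
  have hpl := pluennecke_ruzsa_inequality_nsmul_sub hBne B (e + 1)
  have hpl' : (((e + 1) • B).card : ℝ) ≤ (((B - B).card : ℝ) / B.card) ^ (e + 1) * B.card := by
    have := (NNRat.cast_le (K := ℝ)).2 hpl
    push_cast at this
    exact this
  have hK : ((B - B).card : ℝ) / B.card ≤ 4096 / ε ^ 6 := by
    rw [hBc, div_le_div_iff₀ hSpos (by positivity)]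
    have h1 : ((B - B).card : ℝ) * ε ^ 5 ≤ 1024 * v := by
      have : (v ^ 3) * (((B - B).card : ℝ) * ε ^ 5) ≤ v ^ 3 * (1024 * v) := by nlinarith
      exact le_of_mul_le_mul_left this (by positivity)
    calc ((B - B).card : ℝ) * ε ^ 6 = ((B - B).card : ℝ) * ε ^ 5 * ε := by ring
      _ ≤ 1024 * v * ε := by gcongr
      _ ≤ 4096 * S.card := by linarith
  -- lower bound
  have hlow : S.card * S.card ≤ ((e + 1) • B).card * R := by
    have h := card_mul_le_card_mul' (s := (e + 1) • B) (t := S ×ˢ S)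
      (fun b q => b = P q.1 + e • P q.2) (m := R) (n := 1) ?_ ?_
    · simpa [card_product] using h
    · rintro ⟨a, b⟩ hq
      rw [mem_product] at hq
      rw [Nat.one_le_iff_ne_zero, card_ne_zero]
      refine ⟨P a + e • P b, ?_⟩
      simp only [bipartiteBelow, mem_filter, and_true]
      rw [succ_nsmul']
      exact add_mem_add (mem_image_of_mem _ hq.1) (nsmul_mem_nsmul (mem_image_of_mem _ hq.2))
    · intro d _
      rcases ((S ×ˢ S).bipartiteAbove (fun b q => b = P q.1 + e • P q.2) d).eq_empty_or_nonempty with h0 | ⟨⟨a, b⟩, hab⟩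
      · rw [h0]; simp
      · refine le_trans ?_ (hR b)
        refine card_le_card_of_injOn Prod.snd ?_ ?_
        · rintro ⟨a', b'⟩ h'
          simp only [bipartiteAbove, mem_filter, coe_filter, Set.mem_ofPred_eq, hP] at hab h'
          have h2 := hab.2.symm.trans h'.2
          have h3 := congrArg Prod.fst h2
          have h4 := congrArg Prod.snd h2
          simp [hV] at h3 h4
          subst h3
          simp at h4
          simp [h4]
        · rintro ⟨a', b'⟩ h' ⟨a'', b''⟩ h'' hbb
          simp only [bipartiteAbove, mem_filter, coe_filter, Set.mem_ofPred_eq, hP] at h' h''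
          have h3 := congrArg Prod.fst (h'.2.symm.trans h''.2)
          simp [hV] at h3
          simp at hbb
          rw [h3, hbb]
  have hlow' : (S.card : ℝ) * S.card ≤ (((e + 1) • B).card : ℝ) * R := by exact_mod_cast hlow
  have h5 : (S.card : ℝ) ≤ (4096 / ε ^ 6) ^ (e + 1) * R := by
    have : (S.card : ℝ) * S.card ≤ S.card * ((4096 / ε ^ 6) ^ (e + 1) * R) := by
      calc _ ≤ _ := hlow'
        _ ≤ ((((B - B).card : ℝ) / B.card) ^ (e + 1) * B.card) * R := by gcongr
        _ ≤ ((4096 / ε ^ 6) ^ (e + 1) * B.card) * R := by gcongr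
        _ = _ := by rw [hBc]; ring
    exact le_of_mul_le_mul_left this hSpos
  have h6 : ε * v / 4 ≤ (4096 / ε ^ 6) ^ (e + 1) * R := hS.trans h5
  calc ε ^ (6 * e + 7) * v = 4 * (ε ^ 6) ^ (e + 1) * (ε * v / 4) := by ring
    _ ≤ 4 * (ε ^ 6) ^ (e + 1) * ((4096 / ε ^ 6) ^ (e + 1) * R) := by gcongr
    _ = _ := by rw [div_pow]; field_simp

lemma growth_tensor {V Z : Type*} [Fintype V] [AddCommGroup V] [AddCommGroup Z] (e R : ℕ)
    (hV : ∀ m : V, e • m = 0) (F G H : V → Z)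
    (hR : ∀ m : V, (univ.filter fun m' => e • F m' = e • F m).card ≤ R) (ε : ℝ) (hε : 0 < ε)
    (hcard : ε * (Fintype.card V : ℝ) ^ 2 ≤
      ((univ.filter fun q : V × V => F q.1 + G q.2 + H (-q.1 - q.2) = 0).card : ℝ)) :
    ε ^ (6 * e + 7) * Fintype.card V ≤ R := by
  have hpow : ∀ r : ℕ, (ε ^ (6 * e + 7) * Fintype.card V) ^ r ≤ (4 * 4096 ^ (e + 1)) * (R : ℝ) ^ r := by
    intro r
    have h := growth (V := Fin r → V) (Z := Fin r → Z) e (R ^ r)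
      (fun m => funext fun i => hV (m i)) (fun m i => F (m i)) (fun m i => G (m i))
      (fun m i => H (m i)) ?_ (ε ^ r) (by positivity) ?_
    · simp only [Fintype.card_pi, prod_const, card_univ, Fintype.card_fin] at h
      push_cast at h
      calc _ = _ := by ring
        _ ≤ _ := h
    · intro m
      have key : (Fintype.piFinset fun i => univ.filter fun m' => e • F m' = e • F (m i)).card
          ≤ R ^ r := by
        rw [Fintype.card_piFinset]
        calc _ ≤ ∏ i : Fin r, R := prod_le_prod' fun i _ => hR (m i)
          _ = _ := by simp
      convert key using 2
      ext m'; simp [funext_iff]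
    · have key : ε ^ r * (Fintype.card (Fin r → V) : ℝ) ^ 2 ≤
          ((Fintype.piFinset fun _ : Fin r => univ.filter fun q : V × V =>
            F q.1 + G q.2 + H (-q.1 - q.2) = 0).card : ℝ) := by
        rw [Fintype.card_piFinset]
        simp only [Fintype.card_pi, prod_const, card_univ, Fintype.card_fin]
        push_cast
        calc _ = (ε * (Fintype.card V : ℝ) ^ 2) ^ r := by ring
          _ ≤ _ := by gcongr
      refine key.trans (le_of_eq ?_)
      rw [← card_map (Equiv.arrowProdEquivProdArrow (Fin r) (fun _ => V) (fun _ => V)).toEmbedding]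
      congr 2
      ext q
      simp [funext_iff, mem_map_equiv]
  by_contra! hlt
  have hR0 : 0 < R := by
    have := hR 0
    refine lt_of_lt_of_le ?_ this
    rw [card_pos]; exact ⟨0, by simp⟩
  have hR0' : (0 : ℝ) < R := by exact_mod_cast hR0
  have h1 : 1 < (ε ^ (6 * e + 7) * Fintype.card V) / R := by rwa [one_lt_div hR0']
  obtain ⟨r, hr⟩ := pow_unbounded_of_one_lt (4 * 4096 ^ (e + 1) : ℝ) h1
  rw [div_pow, lt_div_iff₀ (by positivity)] at hr
  exact absurd (hpow r) (not_le.2 hr)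

lemma exists_lift_hom {A B C : Type*} [AddCommGroup A] [Finite A] [AddCommGroup B] [AddCommGroup C]
    (π : B →+ C) (φ : A →+ C)
    (h : ∀ u : A, ∃ v : B, addOrderOf u • v = 0 ∧ π v = φ u) :
    ∃ Φ : A →+ B, ∀ x, π (Φ x) = φ x := by
  obtain ⟨ι, _, n, hn, ⟨E⟩⟩ := AddCommGroup.equiv_directSum_zmod_of_finite' A
  let u : ι → A := fun i => E.symm (DirectSum.of (fun i => ZMod (n i)) i 1)
  choose v hv1 hv2 using fun i => h (u i)
  have hord : ∀ i, addOrderOf (u i) ∣ n i := by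
    intro i
    apply addOrderOf_dvd_of_nsmul_eq_zero
    simp only [u]
    rw [← map_nsmul, ← map_nsmul]
    simp
  have hnv : ∀ i, n i • v i = 0 := by
    intro i
    obtain ⟨q, hq⟩ := hord i
    rw [hq, mul_comm, mul_nsmul', hv1, nsmul_zero]
  let T : ∀ i, ZMod (n i) →+ B := fun i =>
    ZMod.lift (n i) ⟨zmultiplesHom B (v i), by simpa using hnv i⟩
  let Ψ : (DirectSum ι fun i => ZMod (n i)) →+ B := DirectSum.toAddMonoid T
  have hcomp : π.comp Ψ = φ.comp E.symm.toAddMonoidHom := by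
    apply DirectSum.addHom_ext
    intro i y
    obtain ⟨y, rfl⟩ := ZMod.intCast_surjective y
    have e1 : (DirectSum.of (fun i => ZMod (n i)) i (y : ZMod (n i))) =
      y • (DirectSum.of (fun i => ZMod (n i)) i 1) := by
      rw [← map_zsmul]; simp
    rw [e1, map_zsmul, map_zsmul]
    congr 1
    have e2 : Ψ (DirectSum.of (fun i => ZMod (n i)) i 1) = v i := by
      simp only [Ψ, DirectSum.toAddMonoid_of, T]
      have := ZMod.lift_coe (n i) ⟨zmultiplesHom B (v i), by simpa using hnv i⟩ 1
      simpa using this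
    simp only [AddMonoidHom.comp_apply, e2, hv2]
    rfl
  refine ⟨Ψ.comp E.toAddMonoidHom, fun x => ?_⟩
  have := DFunLike.congr_fun hcomp (E x)
  simpa using this

lemma exists_mul_of_cast_eq_zero {M N : ℕ} (hNM : N ∣ M) (v : ZMod M)
    (h : ZMod.castHom hNM (ZMod N) v = 0) : ∃ w : ℤ, v = N * (w : ZMod M) := by
  obtain ⟨v, rfl⟩ := ZMod.intCast_surjective v
  rw [map_intCast, ZMod.intCast_zmod_eq_zero_iff_dvd] at h
  obtain ⟨w, rfl⟩ := h
  exact ⟨w, by push_cast; ring⟩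

lemma exists_obstruction (p : ℕ) (hp : p.Prime) (k : ℕ)
    {A : Type*} [Finite A] [AddCommGroup A]
    (t : A × A × A → ZMod (p ^ k)) (N : ℕ) (hN : 1 < N)
    (a b c : A → ZMod (p ^ k * N))
    (habc : ∀ x y z : A, x + y + z = 0 →
      a x + b y + c z = (N : ZMod (p ^ k * N)) * ((t (x, y, z)).val : ZMod (p ^ k * N)))
    (h1 : ¬ Admissible p k t 1) :
    ∃ φ : A →+ ZMod N,
      (∀ x, ZMod.castHom (Dvd.intro_left (p ^ k) rfl) (ZMod N) (a x) =
        φ x + ZMod.castHom (Dvd.intro_left (p ^ k) rfl) (ZMod N) (a 0)) ∧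
      ∃ u : A, ¬ ∃ v : ZMod (p ^ k * N), addOrderOf u • v = 0 ∧
        ZMod.castHom (Dvd.intro_left (p ^ k) rfl) (ZMod N) v = φ u := by
  set π := ZMod.castHom (Dvd.intro_left (p ^ k) rfl : N ∣ p ^ k * N) (ZMod N) with hπ
  have hpk : p ^ k ≠ 0 := pow_ne_zero _ hp.ne_zero
  have : NeZero (p ^ k) := ⟨hpk⟩
  have h0 : ∀ x y z : A, x + y + z = 0 → π (a x) + π (b y) + π (c z) = 0 := by
    intro x y z h
    rw [← map_add, ← map_add, habc x y z h]
    simp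
  have hb : ∀ y, π (b y) - π (b 0) = π (a y) - π (a 0) := by
    intro y
    have e1 := h0 0 y (-y) (by simp)
    have e2 := h0 y 0 (-y) (by simp)
    linear_combination e1 - e2
  have hc : ∀ y, π (c y) - π (c 0) = π (a y) - π (a 0) := by
    intro y
    have e1 := h0 0 (-y) y (by simp)
    have e2 := h0 y (-y) 0 (by simp)
    linear_combination e1 - e2
  let φ : A →+ ZMod N := AddMonoidHom.mk' (fun x => π (a x) - π (a 0)) (by
    intro x y
    have e1 := h0 x y (-(x + y)) (by abel)
    have e2 := h0 (x + y) 0 (-(x + y)) (by abel)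
    have e3 := hb y
    linear_combination e2 - e1 + e3)
  have hφ : ∀ x, φ x = π (a x) - π (a 0) := fun x => rfl
  refine ⟨φ, fun x => by rw [hφ]; ring, ?_⟩
  by_contra! hcon
  obtain ⟨Φ, hΦ⟩ := exists_lift_hom (π : ZMod (p ^ k * N) →+ ZMod N) φ hcon
  have hΦ' : ∀ x, π (Φ x) = φ x := hΦ
  have ha' : ∀ x, ∃ w : ℤ, a x - a 0 - Φ x = N * (w : ZMod (p ^ k * N)) := fun x =>
    exists_mul_of_cast_eq_zero _ _ (by rw [← hπ, map_sub, map_sub, hΦ', hφ]; ring)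
  have hb' : ∀ x, ∃ w : ℤ, b x - b 0 - Φ x = N * (w : ZMod (p ^ k * N)) := fun x =>
    exists_mul_of_cast_eq_zero _ _ (by rw [← hπ, map_sub, map_sub, hΦ', hφ, hb]; ring)
  have hc' : ∀ x, ∃ w : ℤ, c x - c 0 - Φ x = N * (w : ZMod (p ^ k * N)) := fun x =>
    exists_mul_of_cast_eq_zero _ _ (by rw [← hπ, map_sub, map_sub, hΦ', hφ, hc]; ring)
  choose a' ha' using ha'
  choose b' hb' using hb'
  choose c' hc' using hc'
  apply h1
  refine ⟨fun x => ((a' x + (t (0, 0, 0)).val : ℤ) : ZMod (p ^ k * 1)),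
    fun x => ((b' x : ℤ) : ZMod (p ^ k * 1)), fun x => ((c' x : ℤ) : ZMod (p ^ k * 1)), ?_⟩
  intro x y z hxyz
  have e0 := habc 0 0 0 (by simp)
  have e1 := habc x y z hxyz
  have e2 : Φ x + Φ y + Φ z = 0 := by rw [← map_add, ← map_add, hxyz, map_zero]
  have e3 : ((N * (a' x + (t (0, 0, 0)).val + b' y + c' z - (t (x, y, z)).val) : ℤ) :
      ZMod (p ^ k * N)) = 0 := by
    push_cast
    linear_combination -ha' x - hb' y - hc' z - e0 + e1 - e2
  rw [ZMod.intCast_zmod_eq_zero_iff_dvd] at e3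
  have e4 : ((p ^ k : ℕ) : ℤ) ∣ (a' x + (t (0, 0, 0)).val + b' y + c' z - (t (x, y, z)).val) := by
    push_cast at e3 ⊢
    rw [mul_comm] at e3
    exact Int.dvd_of_mul_dvd_mul_left (by omega) e3
  have e5 : ((p ^ k * 1 : ℕ) : ℤ) ∣ (a' x + (t (0, 0, 0)).val + b' y + c' z - (t (x, y, z)).val) := by
    rwa [mul_one]
  rw [← ZMod.intCast_zmod_eq_zero_iff_dvd] at e5
  push_cast at e5 ⊢
  linear_combination e5

lemma card_triples {X : Type*} [Fintype X] [AddCommGroup X] (Q : X × X × X → Prop) :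
    (univ.filter fun w : X × X × X => w.1 + w.2.1 + w.2.2 = 0 ∧ Q w).card =
    (univ.filter fun q : X × X => Q (q.1, q.2, -q.1 - q.2)).card := by
  symm
  refine card_bij (fun q _ => (q.1, q.2, -q.1 - q.2)) ?_ ?_ ?_
  · intro q hq
    simpa using hq
  · rintro ⟨a, b⟩ _ ⟨a', b'⟩ _ h
    simp only [Prod.mk.injEq] at h
    ext <;> simp [h.1, h.2.1]
  · rintro ⟨x, y, z⟩ hw
    simp only [mem_filter, mem_univ, true_and] at hw
    have hz : z = -x - y := by
      have := hw.1
      rw [eq_comm, ← sub_eq_zero, ← neg_eq_zero, ← this]; abel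
    subst hz
    exact ⟨(x, y), by simpa using hw.2, rfl⟩

lemma exists_shift {X V : Type*} [Fintype X] [AddCommGroup X] [Fintype V] (ι : V → X)
    (W : X × X → Prop) :
    ∃ s : X × X, ((univ.filter W).card : ℝ) / (Fintype.card X : ℝ) ^ 2 * (Fintype.card V : ℝ) ^ 2 ≤
      ((univ.filter fun q : V × V => W (s.1 + ι q.1, s.2 + ι q.2)).card : ℝ) := by
  by_contra! hcon
  have h1 : ∑ s : X × X, ((univ.filter fun q : V × V => W (s.1 + ι q.1, s.2 + ι q.2)).card : ℝ) <
    ∑ s : X × X, ((univ.filter W).card : ℝ) / (Fintype.card X : ℝ) ^ 2 * (Fintype.card V : ℝ) ^ 2 :=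
    sum_lt_sum_of_nonempty univ_nonempty (fun s _ => hcon s)
  have h2 : ∑ s : X × X, (univ.filter fun q : V × V => W (s.1 + ι q.1, s.2 + ι q.2)).card =
      ∑ q : V × V, (univ.filter W).card := by
    simp only [card_filter]
    rw [sum_comm]
    apply sum_congr rfl
    intro q _
    exact Fintype.sum_equiv (Equiv.addRight ((ι q.1, ι q.2) : X × X)) _ _ (fun s => rfl)
  have h3 : ∑ s : X × X, ((univ.filter fun q : V × V => W (s.1 + ι q.1, s.2 + ι q.2)).card : ℝ) =
      ∑ q : V × V, ((univ.filter W).card : ℝ) := by exact_mod_cast h2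
  rw [h3] at h1
  have hX : (Fintype.card X : ℝ) ≠ 0 := by exact_mod_cast Fintype.card_ne_zero
  simp only [sum_const, card_univ, Fintype.card_prod, nsmul_eq_mul] at h1
  push_cast at h1
  apply lt_irrefl _ (h1.trans_eq _)
  field_simp

/-- Exponential decay for XOR games over the full equation distribution
`{x + y + z = 0}` on a finite abelian group, when the minimal admissible `N` exceeds `1`. -/
theorem additive_combinatorics_decay
    (p : ℕ) (hp : p.Prime) (k : ℕ) (hk : 1 ≤ k)
    {A : Type*} [Fintype A] [AddCommGroup A]
    (t : A × A × A → ZMod (p ^ k)) (N : ℕ) (hN : 1 < N)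
    (hadm : Admissible p k t N)
    (hmin : ∀ N' : ℕ, 1 ≤ N' → N' < N → ¬ Admissible p k t N') :
    ∃ c : ℝ, 0 < c ∧ ∀ n : ℕ, 1 ≤ n →
      ∀ (f g h : (Fin n → A) → Fin n → ZMod (p ^ k)),
        ((Finset.univ.filter (fun w : (Fin n → A) × (Fin n → A) × (Fin n → A) =>
            w.1 + w.2.1 + w.2.2 = 0 ∧
            ∀ i, f w.1 i + g w.2.1 i + h w.2.2 i = t (w.1 i, w.2.1 i, w.2.2 i))).card : ℝ)
          / ((Finset.univ.filter (fun w : (Fin n → A) × (Fin n → A) × (Fin n → A) =>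
              w.1 + w.2.1 + w.2.2 = 0)).card : ℝ)
        ≤ (2 : ℝ) ^ (-(c * n)) := by
  obtain ⟨a, b, c, habc⟩ := hadm
  obtain ⟨φ, hφ, u, hu⟩ := exists_obstruction p hp k t N hN a b c habc (hmin 1 le_rfl hN)
  set π := ZMod.castHom (Dvd.intro_left (p ^ k) rfl : N ∣ p ^ k * N) (ZMod N) with hπ
  have : NeZero (p ^ k) := ⟨pow_ne_zero _ hp.ne_zero⟩
  set e := addOrderOf u with he
  let H : AddSubgroup A := AddSubgroup.zmultiples u
  let L : AddSubgroup (ZMod N) :=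
    (nsmulAddMonoidHom (α := ZMod (p ^ k * N)) e).ker.map (π : ZMod (p ^ k * N) →+ ZMod N)
  have hL : ∀ y, y ∈ L ↔ ∃ v : ZMod (p ^ k * N), e • v = 0 ∧ π v = y := by
    intro y
    simp only [L, AddSubgroup.mem_map, AddMonoidHom.mem_ker, nsmulAddMonoidHom_apply]
    rfl
  let K0 : AddSubgroup H := L.comap (φ.comp H.subtype)
  have hK0 : 2 * Nat.card K0 ≤ Nat.card H := by
    have hne : K0 ≠ ⊤ := by
      intro htop
      have : (⟨u, AddSubgroup.mem_zmultiples u⟩ : H) ∈ K0 := by rw [htop]; trivial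
      exact hu ((hL _).1 this)
    have h1 := AddSubgroup.card_mul_index K0
    have h2 : K0.index ≠ 1 := fun h => hne (AddSubgroup.index_eq_one.1 h)
    have h3 : K0.index ≠ 0 := AddSubgroup.index_ne_zero_of_finite
    have h4 : 2 ≤ K0.index := by omega
    calc 2 * Nat.card K0 = Nat.card K0 * 2 := mul_comm _ _
      _ ≤ Nat.card K0 * K0.index := by gcongr
      _ = _ := h1
  have hH : ∀ m : H, e • m = 0 := by
    rintro ⟨m, hm⟩
    obtain ⟨z, rfl⟩ := AddSubgroup.mem_zmultiples_iff.1 hm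
    ext
    show e • z • u = 0
    rw [smul_comm, he, addOrderOf_nsmul_eq_zero, smul_zero]
  refine ⟨1 / ((6 * e + 7 : ℕ) : ℝ), by positivity, ?_⟩
  intro n hn f g h
  have hnum := card_triples (X := Fin n → A)
    (fun w => ∀ i, f w.1 i + g w.2.1 i + h w.2.2 i = t (w.1 i, w.2.1 i, w.2.2 i))
  have hden := card_triples (X := Fin n → A) (fun _ => True)
  simp only [and_true, filter_true, card_univ, Fintype.card_prod] at hden
  set W : (Fin n → A) × (Fin n → A) → Prop := fun q =>
    ∀ i, f q.1 i + g q.2 i + h (-q.1 - q.2) i = t (q.1 i, q.2 i, (-q.1 - q.2) i) with hW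
  set ε : ℝ := ((univ.filter W).card : ℝ) / (Fintype.card (Fin n → A) : ℝ) ^ 2 with hεdef
  have hgoal : ε ≤ (2 : ℝ) ^ (-(1 / ((6 * e + 7 : ℕ) : ℝ) * n)) := by
    rcases (show 0 ≤ ε by positivity).eq_or_lt with h0 | hε
    · rw [← h0]; positivity
    obtain ⟨⟨x0, y0⟩, hs⟩ := exists_shift (X := Fin n → A) (V := Fin n → H)
      (fun m i => (m i : A)) W
    have hs' := le_trans (le_of_eq (show ε * (Fintype.card (Fin n → H) : ℝ) ^ 2 = _ by
      rw [hεdef]; congr!)) hs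
    have hgr := growth_tensor (V := Fin n → H) (Z := Fin n → ZMod (p ^ k * N)) e (Nat.card K0 ^ n)
      (fun m => funext fun i => hH (m i))
      (fun m i => a (x0 i + m i) - N * ((f (x0 + fun i => (m i : A)) i).val : ZMod (p ^ k * N)))
      (fun m i => b (y0 i + m i) - N * ((g (y0 + fun i => (m i : A)) i).val : ZMod (p ^ k * N)))
      (fun m i => c (-x0 i - y0 i + m i) -
        N * ((h (-x0 - y0 + fun i => (m i : A)) i).val : ZMod (p ^ k * N)))
      ?_ ε hε ?_
    · have h1 : (2 : ℝ) ^ n * (Nat.card K0 : ℝ) ^ n ≤ (Nat.card H : ℝ) ^ n := by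
        rw [← mul_pow]; gcongr; exact_mod_cast hK0
      have h2 : (Fintype.card (Fin n → H) : ℝ) = (Nat.card H : ℝ) ^ n := by
        simp [Nat.card_eq_fintype_card]
      rw [h2] at hgr
      push_cast at hgr
      have hHpos : (0 : ℝ) < (Nat.card H : ℝ) ^ n := by
        have : 0 < Nat.card H := Nat.card_pos
        positivity
      have h3 : ε ^ (6 * e + 7) * (2 : ℝ) ^ n ≤ 1 := by
        have : (Nat.card H : ℝ) ^ n * (ε ^ (6 * e + 7) * (2 : ℝ) ^ n) ≤ (Nat.card H : ℝ) ^ n * 1 := by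
          calc _ = (2 : ℝ) ^ n * (ε ^ (6 * e + 7) * (Nat.card H : ℝ) ^ n) := by ring
            _ ≤ (2 : ℝ) ^ n * (Nat.card K0 : ℝ) ^ n := by gcongr
            _ ≤ _ := by rw [mul_one]; exact h1
        exact le_of_mul_le_mul_left this hHpos
      apply le_of_pow_le_pow_left₀ (n := 6 * e + 7) (by omega) (by positivity)
      rw [← Real.rpow_natCast ((2 : ℝ) ^ _), ← Real.rpow_mul (by norm_num)]
      have h4 : -(1 / ((6 * e + 7 : ℕ) : ℝ) * n) * ((6 * e + 7 : ℕ) : ℝ) = -(n : ℝ) := by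
        have : ((6 * e + 7 : ℕ) : ℝ) ≠ 0 := by positivity
        field_simp
      rw [h4, Real.rpow_neg (by norm_num), Real.rpow_natCast, ← one_div, le_div_iff₀ (by positivity)]
      exact h3
    · intro m
      have hsub : ∀ m' : Fin n → H,
          (e • (fun i => a (x0 i + m' i) - N * ((f (x0 + fun i => (m' i : A)) i).val : ZMod (p ^ k * N)))
          = e • (fun i => a (x0 i + m i) - N * ((f (x0 + fun i => (m i : A)) i).val : ZMod (p ^ k * N))))
          → ∀ i, m' i - m i ∈ K0 := by
        intro m' hm' i
        have h1 := congrFun hm' i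
        simp only [Pi.smul_apply] at h1
        rw [← sub_eq_zero, ← nsmul_sub] at h1
        refine (hL _).2 ⟨_, h1, ?_⟩
        have hN0 : ((N : ℕ) : ZMod N) = 0 := ZMod.natCast_self N
        have hgo : φ ((m' i - m i : H) : A) = φ (m' i) - φ (m i) := by
          rw [← map_sub]; rfl
        rw [AddMonoidHom.comp_apply, AddSubgroup.coe_subtype, hgo, map_sub, map_sub, map_sub,
          map_mul, map_mul, map_natCast, hN0, hφ (x0 i + m' i), hφ (x0 i + m i), map_add, map_add]
        ring
      have hcardK : Nat.card K0 = (univ.filter fun y : H => y ∈ K0).card := by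
        rw [Nat.card_eq_fintype_card, Fintype.card_subtype]
      have hle : ((Fintype.piFinset fun i : Fin n => univ.filter fun y : H => y - m i ∈ K0)).card
          ≤ Nat.card K0 ^ n := by
        rw [Fintype.card_piFinset]
        calc _ ≤ ∏ i : Fin n, Nat.card K0 := by
              apply prod_le_prod'
              intro i _
              rw [hcardK]
              refine card_le_card_of_injOn (fun y => y - m i) ?_ ?_
              · intro y hy; simpa using hy
              · intro y _ y' _ hyy; simpa using hyy
          _ = _ := by simp
      refine le_trans (card_le_card ?_) hle
      intro m' hm'
      rw [Fintype.mem_piFinset]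
      intro i
      simp only [mem_filter, mem_univ, true_and] at hm' ⊢
      exact hsub m' hm' i
    · refine hs'.trans ?_
      rw [Nat.cast_le]
      apply card_le_card
      rintro ⟨m, l⟩ hq
      simp only [mem_filter, mem_univ, true_and] at hq ⊢
      funext i
      have hwin := hq i
      have hz : (-(x0 + fun i => (m i : A)) - (y0 + fun i => (l i : A))) =
          (-x0 - y0 + fun i => ((-m - l) i : A)) := by
        funext j; simp; abel
      rw [hz] at hwin
      have hsum := habc (x0 i + m i) (y0 i + l i) (-x0 i - y0 i + ((-m - l) i : H)) (by
        simp; abel)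
      have hN' : ∀ z : ℤ, (z : ZMod (p ^ k)) = 0 → (N : ZMod (p ^ k * N)) * (z : ZMod (p ^ k * N)) = 0 := by
        intro z hz
        rw [ZMod.intCast_zmod_eq_zero_iff_dvd] at hz
        obtain ⟨w, rfl⟩ := hz
        have : ((p ^ k * N : ℕ) : ZMod (p ^ k * N)) = 0 := ZMod.natCast_self _
        push_cast at this ⊢
        linear_combination (w : ZMod (p ^ k * N)) * this
      have hz2 := hN' (((f (x0 + fun i => (m i : A)) i).val : ℤ) + ((g (y0 + fun i => (l i : A)) i).val : ℤ)
        + ((h (-x0 - y0 + fun i => ((-m - l) i : A)) i).val : ℤ)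
        - ((t (x0 i + m i, y0 i + l i, -x0 i - y0 i + ((-m - l) i : H))).val : ℤ)) (by
          push_cast
          simp only [ZMod.natCast_val, ZMod.cast_id', id_eq]
          rw [sub_eq_zero]
          exact hwin)
      push_cast at hz2
      simp only [Pi.add_apply, Pi.zero_apply]
      linear_combination hsum - hz2
  refine le_trans (le_of_eq ?_) hgoal
  rw [hεdef]
  congr 1
  · rw [Nat.cast_inj]
    convert hnum
  · rw [sq]
    exact_mod_cast hden
end

section
/- For every integer m ≥ 2 there is a constant C > 0 (depending only on m) with the following property. Let 𝒜 be a finite abelian group, n ≥ 1, ε ∈ (0,1], and let f̃, g̃, h̃ : 𝒜^n → ℤ_m^n be functions such that the probability, over (x,y,z) chosen uniformly from { (x,y,z) ∈ (𝒜^n)³ : x + y + z = 0 }, that f̃(x) + g̃(y) + h̃(z) = 0 in ℤ_m^n is at least ε. Then there exists a subset 𝒜' ⊆ 𝒜^n with |𝒜'| ≥ ε^C·|𝒜|^n / C such that f̃ is a Freiman homomorphism of order m on 𝒜', i.e., whenever x_1, …, x_m, y_1, …, y_m ∈ 𝒜' satisfy x_1 + ⋯ + x_m = y_1 + ⋯ +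 y_m, we have f̃(x_1) + ⋯ + f̃(x_m) = f̃(y_1) + ⋯ + f̃(y_m). -/
open Finset
open scoped Pointwise
attribute [local instance] Classical.propDecidable

lemma fs_comb {G : Type} [Fintype G] (E : G → G → Prop) (ε : ℝ) (hε : 0 < ε)
    (hG : 0 < Fintype.card G)
    (h : ε * (Fintype.card G : ℝ)^2 ≤ ((univ.filter (fun p : G × G => E p.1 p.2)).card : ℝ)) :
    ∃ X : Finset G, ε * (Fintype.card G : ℝ) / 4 ≤ X.card ∧ ∀ x ∈ X, ∀ x'' ∈ X,
      ε^5 * (Fintype.card G : ℝ)^3 / 1024 ≤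
        ((univ.filter (fun p : G × G × G =>
          E x p.2.1 ∧ E p.1 p.2.1 ∧ E p.1 p.2.2 ∧ E x'' p.2.2)).card : ℝ) := by
  set N : ℝ := (Fintype.card G : ℝ) with hN
  have hN0 : 0 < N := by rw [hN]; exact_mod_cast hG
  let nb : G → Finset G := fun y => univ.filter (fun x => E x y)
  let cm : G → G → Finset G := fun x x' => univ.filter (fun y => E x y ∧ E x' y)
  let bad : G → G → Prop := fun x x' => ((cm x x').card : ℝ) < ε^2 * N / 16
  let bp : G → Finset (G × G) := fun y =>
    univ.filter (fun p : G × G => (E p.1 y ∧ E p.2 y) ∧ bad p.1 p.2)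
  have h1 : ε * N^2 ≤ ∑ y, ((nb y).card : ℝ) := by
    refine h.trans (le_of_eq ?_)
    norm_cast
    simp only [nb, card_filter]
    rw [Fintype.sum_prod_type_right]
  have h2 : ε^2 * N^3 ≤ ∑ y, ((nb y).card : ℝ)^2 := by
    have h3 := sq_sum_le_card_mul_sum_sq (s := (univ : Finset G)) (f := fun y => ((nb y).card : ℝ))
    rw [card_univ, ← hN] at h3
    have h4 : (ε * N^2)^2 ≤ (∑ y, ((nb y).card : ℝ))^2 := by gcongr
    have h5 : N * (ε^2 * N^3) ≤ N * ∑ y, ((nb y).card : ℝ)^2 := by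
      calc _ = (ε * N^2)^2 := by ring
        _ ≤ _ := h4.trans h3
    exact le_of_mul_le_mul_left h5 hN0
  have h3 : ∑ y, ((bp y).card : ℝ) ≤ ε^2 * N^3 / 16 := by
    have e : ∑ y, ((bp y).card : ℝ) =
        ∑ p : G × G, if bad p.1 p.2 then ((cm p.1 p.2).card : ℝ) else 0 := by
      simp only [bp, cm, card_filter]
      push_cast
      rw [sum_comm]
      refine sum_congr rfl fun p _ => ?_
      by_cases hb : bad p.1 p.2 <;> simp [hb]
    rw [e]
    calc _ ≤ ∑ p : G × G, ε^2 * N / 16 := by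
          refine sum_le_sum fun p _ => ?_
          split_ifs with hb
          · exact hb.le
          · positivity
      _ = _ := by
          rw [sum_const, card_univ, Fintype.card_prod, nsmul_eq_mul]; push_cast
          rw [← hN]; ring
  obtain ⟨y, hy⟩ : ∃ y, ε^2 * N^2 / 2 ≤ ((nb y).card : ℝ)^2 - 8 * ((bp y).card : ℝ) := by
    by_contra! hc
    have : Nonempty G := Fintype.card_pos_iff.1 hG
    have := sum_lt_sum_of_nonempty (s := (univ : Finset G)) univ_nonempty (fun y _ => hc y)
    rw [sum_sub_distrib, ← mul_sum, sum_const, card_univ, nsmul_eq_mul, ← hN] at this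
    nlinarith
  set M : ℝ := ((nb y).card : ℝ) with hM
  have hM0 : 0 ≤ M := by positivity
  have hMl : ε * N / 2 ≤ M := by
    have : (0:ℝ) ≤ ((bp y).card : ℝ) := by positivity
    by_contra! hc
    have : M^2 < (ε * N / 2)^2 := by gcongr
    nlinarith [mul_pos hε hN0, mul_pos (mul_pos hε hN0) (mul_pos hε hN0)]
  have hMp : 0 < M := lt_of_lt_of_le (by positivity) hMl
  have hbp : 8 * ((bp y).card : ℝ) ≤ M^2 := by
    have : 0 ≤ ε^2 * N^2 / 2 := by positivity
    linarith
  let bd : G → Finset G := fun x => (nb y).filter (fun x' => bad x x')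
  let X := (nb y).filter (fun x => ((bd x).card : ℝ) ≤ M / 4)
  let Y := (nb y).filter (fun x => ¬ ((bd x).card : ℝ) ≤ M / 4)
  have hXY : (X.card : ℝ) + Y.card = M := by
    rw [hM]; norm_cast; exact card_filter_add_card_filter_not _
  have hbs : ∑ x ∈ nb y, ((bd x).card : ℝ) = (bp y).card := by
    norm_cast
    simp only [bd, bp, nb, card_filter, sum_filter, Fintype.sum_prod_type]
    refine sum_congr rfl fun x _ => ?_
    by_cases hx : E x y
    · simp only [hx, true_and, if_true]
      refine sum_congr rfl fun z _ => ?_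
      by_cases hz : E z y <;> simp [hz]
    · simp [hx]
  have hY : (Y.card : ℝ) * (M / 4) ≤ (bp y).card := by
    rw [← hbs]
    calc _ = ∑ x ∈ Y, M / 4 := by simp
      _ ≤ ∑ x ∈ Y, ((bd x).card : ℝ) := sum_le_sum fun x hx => by
          have := (mem_filter.1 hx).2
          exact (not_le.1 this).le
      _ ≤ _ := sum_le_sum_of_subset_of_nonneg (filter_subset _ _) (fun _ _ _ => by positivity)
  have hY2 : (Y.card : ℝ) ≤ M / 2 := by
    by_contra! hc
    nlinarith
  refine ⟨X, by linarith, fun x hx x'' hx'' => ?_⟩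
  have hx1 := (mem_filter.1 hx).2
  have hx2 := (mem_filter.1 hx'').2
  let Z := (nb y).filter (fun x' => ¬ bad x x' ∧ ¬ bad x'' x')
  have hZ : M / 2 ≤ (Z.card : ℝ) := by
    have : nb y ⊆ Z ∪ (bd x ∪ bd x'') := by
      intro z hz
      simp only [Z, bd, mem_union, mem_filter, hz, true_and]
      tauto
    have h5 := (card_le_card this).trans ((card_union_le _ _).trans
      (Nat.add_le_add_left (card_union_le _ _) _))
    have h6 : M ≤ Z.card + ((bd x).card + (bd x'').card) := by rw [hM]; exact_mod_cast h5
    linarith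
  have key : (∑ z ∈ Z, ((cm x z).card : ℝ) * ((cm x'' z).card : ℝ)) ≤
      ((univ.filter (fun p : G × G × G =>
          E x p.2.1 ∧ E p.1 p.2.1 ∧ E p.1 p.2.2 ∧ E x'' p.2.2)).card : ℝ) := by
    have e : ((univ.filter (fun p : G × G × G =>
          E x p.2.1 ∧ E p.1 p.2.1 ∧ E p.1 p.2.2 ∧ E x'' p.2.2)).card : ℝ) =
        ∑ z, ((cm x z).card : ℝ) * ((cm x'' z).card : ℝ) := by
      norm_cast
      rw [card_filter, Fintype.sum_prod_type]
      refine sum_congr rfl fun z _ => ?_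
      rw [← card_product, ← card_filter]
      congr 1
      ext ⟨a, b⟩
      simp [cm]
      tauto
    rw [e]
    exact sum_le_sum_of_subset_of_nonneg (subset_univ _) (fun _ _ _ => by positivity)
  refine le_trans ?_ key
  calc ε^5 * N^3 / 1024 = (ε * N / 2 / 2) * ((ε^2 * N/16) * (ε^2 * N/16)) := by ring
    _ ≤ (Z.card : ℝ) * ((ε^2 * N/16) * (ε^2 * N/16)) := by gcongr; linarith
    _ = ∑ z ∈ Z, ((ε^2 * N/16) * (ε^2 * N/16)) := by simp
    _ ≤ _ := by
      refine sum_le_sum fun z hz => ?_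
      have := (mem_filter.1 hz).2
      have a1 := not_lt.1 this.1
      have a2 := not_lt.1 this.2
      gcongr

lemma fs_bsg {G H : Type} [Fintype G] [AddCommGroup G] [AddCommGroup H] (f g h : G → H)
    (ε : ℝ) (hε : 0 < ε)
    (hh : ε * (Fintype.card G : ℝ)^2 ≤
      ((univ.filter (fun p : G × G => f p.1 + g p.2 + h (-p.1-p.2) = 0)).card : ℝ)) :
    ∃ X : Finset G, ε * (Fintype.card G : ℝ) / 4 ≤ X.card ∧
      (X.image (fun x => (x, f x)) - X.image (fun x => (x, f x))).card * ε^5 ≤ 1024 * (Fintype.card G : ℝ) := by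
  have hG : 0 < Fintype.card G := Fintype.card_pos
  obtain ⟨X, hX, hp⟩ := fs_comb (fun x y => f x + g y + h (-x-y) = 0) ε hε hG hh
  refine ⟨X, hX, ?_⟩
  set N : ℝ := (Fintype.card G : ℝ) with hN
  have hN0 : 0 < N := by rw [hN]; exact_mod_cast hG
  set D := (X.image (fun x => (x, f x)) - X.image (fun x => (x, f x))) with hD
  let F : G × G × G × G → G × H := fun q =>
    (q.2.1 - q.1 + (q.2.2.2 - q.2.2.1), h q.2.1 - h q.1 + (h q.2.2.2 - h q.2.2.1))
  have h1 : ∀ d ∈ D, ε^5 * N^3 / 1024 ≤ ((univ.filter (fun q => F q = d)).card : ℝ) := by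
    intro d hd
    obtain ⟨a, ha, b, hb, rfl⟩ := mem_sub.1 hd
    obtain ⟨x, hx, rfl⟩ := mem_image.1 ha
    obtain ⟨z, hz, rfl⟩ := mem_image.1 hb
    refine (hp x hx z hz).trans ?_
    norm_cast
    refine card_le_card_of_injOn (fun p => (-x-p.2.1, -p.1-p.2.1, -p.1-p.2.2, -z-p.2.2)) ?_ ?_
    · rintro ⟨w, y, y'⟩ hw
      simp only [coe_filter, mem_univ, true_and, Set.mem_ofPred_eq] at hw ⊢
      obtain ⟨e1, e2, e3, e4⟩ := hw
      simp only [F, Prod.mk_sub_mk, Prod.mk.injEq]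
      refine ⟨by abel, ?_⟩
      have i1 := eq_neg_of_add_eq_zero_right e1
      have i2 := eq_neg_of_add_eq_zero_right e2
      have i3 := eq_neg_of_add_eq_zero_right e3
      have i4 := eq_neg_of_add_eq_zero_right e4
      rw [i1, i2, i3, i4]; abel
    · rintro ⟨w, y, y'⟩ _ ⟨w2, y2, y2'⟩ _ he
      simp only [Prod.mk.injEq] at he
      obtain ⟨e1, e2, e3, e4⟩ := he
      have j1 := sub_right_injective e1
      have j4 := sub_right_injective e4
      subst j1 j4
      have := neg_injective (sub_left_injective e2)
      subst this
      rfl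
  have h2 : (∑ d ∈ D, ((univ.filter (fun q => F q = d)).card : ℝ)) ≤ N^4 := by
    have : (∑ d ∈ D, (univ.filter (fun q => F q = d)).card) ≤ (univ : Finset (G×G×G×G)).card :=
by
      rw [← card_biUnion]
      · exact card_le_univ _
      · intro a _ b _ hab
        rw [Function.onFun, disjoint_left]
        intro q hq hq'
        exact hab ((mem_filter.1 hq).2.symm.trans (mem_filter.1 hq').2)
    rw [card_univ] at this
    simp only [Fintype.card_prod] at this
    calc _ ≤ ((Fintype.card G * (Fintype.card G * (Fintype.card G * Fintype.card G)) : ℕ) : ℝ) := by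
          exact_mod_cast this
      _ = N^4 := by push_cast; rw [← hN]; ring
  have h3 : (D.card : ℝ) * (ε^5 * N^3 / 1024) ≤ N^4 := by
    refine le_trans ?_ h2
    rw [← nsmul_eq_mul]
    exact card_nsmul_le_sum _ _ _ h1
  have h4 : N^3 * ((D.card : ℝ) * ε^5) ≤ N^3 * (1024 * N) := by nlinarith
  exact le_of_mul_le_mul_left h4 (by positivity)

lemma fs_half {m n : ℕ} (hm : 2 ≤ m) (V : Finset (Fin n → ZMod m)) (hV : 0 ∉ V) :
    ∃ r : (Fin n → ZMod m) →+ ZMod m, 2 * (V.filter (fun v => r v = 0)).card ≤ V.card := by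
  have : NeZero m := ⟨by omega⟩
  have : Fact (1 < m) := ⟨hm⟩
  let ev : (Fin n → ZMod m) → (Fin n → ZMod m) →+ ZMod m := fun v =>
    { toFun := fun r => ∑ i, r i * v i
      map_zero' := by simp
      map_add' := by intro a b; simp [add_mul, sum_add_distrib] }
  have hk : ∀ v ∈ V, 2 * (univ.filter (fun r => ev v r = 0)).card ≤ Fintype.card (Fin n → ZMod m) := by
    intro v hv
    have hv0 : v ≠ 0 := fun h => hV (h ▸ hv)
    obtain ⟨i, hi⟩ := Function.ne_iff.1 hv0
    have hs : ev v (Pi.single i 1) ≠ 0 := by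
      simpa [ev, Pi.single_apply] using hi
    set K := univ.filter (fun r => ev v r = 0)
    have hd : Disjoint K (K.image (fun r => r + Pi.single i 1)) := by
      rw [disjoint_left]
      intro a ha hb'
      obtain ⟨b, hb, rfl⟩ := mem_image.1 hb'
      simp only [K, mem_filter, mem_univ, true_and, map_add] at ha hb
      rw [hb, zero_add] at ha
      exact hs ha
    have := card_le_univ (K ∪ K.image (fun r => r + Pi.single i 1))
    rw [card_union_of_disjoint hd, card_image_of_injective _ (add_left_injective _)] at this
    omega
  by_contra! hc
  have h1 : ∑ r, 2 * (V.filter (fun v => ev v r = 0)).card ≤ ∑ r : Fin n → ZMod m, V.card := by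
    have : ∑ r, 2 * (V.filter (fun v => ev v r = 0)).card =
        ∑ v ∈ V, 2 * (univ.filter (fun r => ev v r = 0)).card := by
      rw [← mul_sum, ← mul_sum]
      simp only [card_filter]
      rw [sum_comm]
    rw [this]
    refine (sum_le_sum hk).trans ?_
    simp [mul_comm]
  refine absurd h1 (not_le.2 (sum_lt_sum_of_nonempty univ_nonempty fun r _ => ?_))
  have := hc (ev r)
  have e : V.filter (fun v => ev v r = 0) = V.filter (fun v => ev r v = 0) := by
    refine filter_congr fun v _ => ?_
    simp only [ev, AddMonoidHom.coe_mk, ZeroHom.coe_mk, mul_comm]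
  rw [e]
  exact this

lemma fs_sep {G : Type} {m n : ℕ} (hm : 2 ≤ m) (f : G → Fin n → ZMod m) (k : ℕ) :
    ∀ (V : Finset (Fin n → ZMod m)), 0 ∉ V → V.card < 2^k → ∀ X : Finset G,
    ∃ X' ⊆ X, X.card ≤ m^k * X'.card ∧ ∀ (u v : Fin m → G), (∀ i, u i ∈ X') → (∀ i, v i ∈ X') →
      (∑ i, f (u i) - ∑ i, f (v i)) ∉ V := by
  have : NeZero m := ⟨by omega⟩
  induction k with
  | zero =>
    intro V _ hc X
    have : V = ∅ := by simpa using hc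
    subst this
    exact ⟨X, Subset.rfl, by simp, by simp⟩
  | succ k ih =>
    intro V hV hc X
    obtain ⟨r, hr⟩ := fs_half hm V hV
    obtain ⟨c, -, hcX⟩ : ∃ c ∈ (univ : Finset (ZMod m)),
        X.card ≤ m * (X.filter (fun x => r (f x) = c)).card := by
      by_contra! hcon
      have h1 := sum_lt_sum_of_nonempty univ_nonempty hcon
      rw [← mul_sum, ← card_eq_sum_card_fiberwise (fun _ _ => mem_coe.2 (mem_univ _))] at h1
      simp [ZMod.card] at h1
    obtain ⟨X', hs, hcard, hX'⟩ := ih (V.filter (fun v => r v = 0))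
      (fun h => hV (mem_filter.1 h).1) (by rw [pow_succ] at hc; omega)
      (X.filter (fun x => r (f x) = c))
    refine ⟨X', hs.trans (filter_subset _ _), ?_, fun u v hu hv hmem => ?_⟩
    · calc _ ≤ _ := hcX
        _ ≤ m * (m^k * X'.card) := Nat.mul_le_mul_left _ hcard
        _ = _ := by ring
    · refine hX' u v hu hv (mem_filter.2 ⟨hmem, ?_⟩)
      rw [map_sub, map_sum, map_sum]
      rw [sum_congr rfl (fun i _ => (mem_filter.1 (hs (hu i))).2),
        sum_congr rfl (fun i _ => (mem_filter.1 (hs (hv i))).2), sub_self]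

lemma fs_V {G H : Type} [AddCommGroup G] [AddCommGroup H] (f : G → H) (X : Finset G)
    (hX : X.Nonempty) (K : ℝ) (m : ℕ)
    (hK : ((X.image (fun x => (x, f x)) - X.image (fun x => (x, f x))).card : ℝ) ≤ K * X.card)
    (V : Finset H)
    (hV : ∀ w ∈ V, ((0 : G), w) ∈ m • X.image (fun x => (x, f x)) - m • X.image (fun x => (x, f x))) :
    (V.card : ℝ) ≤ K^(2*m+1) := by
  set Γ := X.image (fun x => (x, f x)) with hΓ
  have hc : Γ.card = X.card := card_image_of_injective _ (fun a b h => (Prod.mk.inj h).1)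
  have hΓn : Γ.Nonempty := hX.image _
  have hX0 : (0:ℝ) < X.card := by exact_mod_cast hX.card_pos
  have p := pluennecke_ruzsa_inequality_nsmul_sub_nsmul_sub hΓn Γ (m+1) m
  have p' : (((m+1) • Γ - m • Γ).card : ℝ) ≤ ((Γ - Γ).card / Γ.card : ℝ)^(m+1+m) * Γ.card := by
    have p2 := (NNRat.cast_le (K := ℝ)).2 p
    push_cast at p2
    exact p2
  have q : V.card * X.card ≤ ((m+1) • Γ - m • Γ).card := by
    rw [← card_product]
    refine card_le_card_of_injOn (fun t => (t.2, f t.2 + t.1)) ?_ ?_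
    · rintro ⟨w, x⟩ h
      obtain ⟨hw, hx⟩ := mem_product.1 (mem_coe.1 h)
      obtain ⟨a, ha, b, hb, hab⟩ := mem_sub.1 (hV w hw)
      refine mem_coe.2 (mem_sub.2 ⟨a + (x, f x), ?_, b, hb, ?_⟩)
      · rw [succ_nsmul]
        exact add_mem_add ha (mem_image_of_mem _ hx)
      · rw [add_sub_right_comm, hab]; simp [add_comm]
    · rintro ⟨w, x⟩ _ ⟨w2, x2⟩ _ h
      simp only [Prod.mk.injEq] at h
      obtain ⟨rfl, h⟩ := h
      rw [add_left_cancel h]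
  have q' : (V.card : ℝ) * X.card ≤ (((m+1) • Γ - m • Γ).card : ℝ) := by exact_mod_cast q
  have r : ((Γ - Γ).card / Γ.card : ℝ) ≤ K := by
    rw [hc, div_le_iff₀ hX0]; exact hK
  have e : m + 1 + m = 2 * m + 1 := by ring
  rw [hc] at p' r
  have t : ((Γ - Γ).card / X.card : ℝ)^(m+1+m) ≤ K^(2*m+1) := by
    rw [e]; gcongr
  have := (q'.trans p').trans (mul_le_mul_of_nonneg_right t hX0.le)
  exact le_of_mul_le_mul_right this hX0

lemma fs_sum_mem {Q : Type} [DecidableEq Q] [AddCommGroup Q] (S : Finset Q) (m : ℕ) (u : Fin m → Q)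
    (hu : ∀ i, u i ∈ S) : ∑ i, u i ∈ m • S :=
  mem_nsmul.2 ⟨fun i => ⟨u i, hu i⟩, by simp [List.sum_ofFn]⟩

lemma fs_core (m : ℕ) (hm : 2 ≤ m) {G H : Type} [Fintype G] [AddCommGroup G]
    [Fintype H] [AddCommGroup H] (f g h : G → H) (ε : ℝ) (hε : 0 < ε)
    (hsep : ∀ (k : ℕ) (V : Finset H), 0 ∉ V → V.card < 2^k → ∀ X : Finset G,
      ∃ X' ⊆ X, X.card ≤ m^k * X'.card ∧ ∀ (u v : Fin m → G), (∀ i, u i ∈ X') →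
        (∀ i, v i ∈ X') → (∑ i, f (u i) - ∑ i, f (v i)) ∉ V)
    (hh : ε * (Fintype.card G : ℝ)^2 ≤
      ((univ.filter (fun p : G × G => f p.1 + g p.2 + h (-p.1-p.2) = 0)).card : ℝ)) :
    ∃ X : Finset G, ε * (Fintype.card G : ℝ) / 4 ≤
        (2 * (4096 / ε^6)^(2*m+1))^m * X.card ∧
      ∀ (u v : Fin m → G), (∀ i, u i ∈ X) → (∀ i, v i ∈ X) → ∑ i, u i = ∑ i, v i →
        ∑ i, f (u i) = ∑ i, f (v i) := by
  have : NeZero m := ⟨by omega⟩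
  obtain ⟨X, hX, hD⟩ := fs_bsg f g h ε hε hh
  have hG : (0:ℝ) < Fintype.card G := by exact_mod_cast (Fintype.card_pos : 0 < Fintype.card G)
  have hX0 : (0:ℝ) < X.card := lt_of_lt_of_le (by positivity) hX
  have hXn : X.Nonempty := card_pos.1 (by exact_mod_cast hX0)
  set Γ := X.image (fun x => (x, f x)) with hΓ
  set K : ℝ := 4096 / ε^6 with hKd
  have hK : ((Γ - Γ).card : ℝ) ≤ K * X.card := by
    rw [hKd, div_mul_eq_mul_div, le_div_iff₀ (by positivity)]
    nlinarith
  let U : Finset (H) := univ.filter (fun w => ((0:G), w) ∈ m • Γ - m • Γ)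
  have hU : (U.card : ℝ) ≤ K^(2*m+1) :=
    fs_V f X hXn K m hK U (fun w hw => (mem_filter.1 hw).2)
  have h0 : (0 : H) ∈ U := by
    refine mem_filter.2 ⟨mem_univ _, ?_⟩
    obtain ⟨a, ha⟩ : (m • Γ).Nonempty := (hXn.image _).nsmul
    exact mem_sub.2 ⟨a, ha, a, ha, sub_self a⟩
  have hU0 : U.card ≠ 0 := card_ne_zero_of_mem h0
  set k := Nat.log 2 U.card + 1 with hk
  obtain ⟨X', hs, hc, hX'⟩ := hsep k (U.erase 0) (by simp)
    ((card_erase_le).trans_lt (Nat.lt_pow_succ_log_self (by norm_num) _)) X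
  refine ⟨X', ?_, fun u v hu hv huv => ?_⟩
  · refine hX.trans ?_
    have h2k : 2^k ≤ 2 * U.card := by
      rw [hk, pow_succ, mul_comm]
      exact Nat.mul_le_mul_left _ (Nat.pow_log_le_self 2 hU0)
    have hmk : m^k ≤ (2 * U.card)^m := by
      calc m^k ≤ (2^m)^k := Nat.pow_le_pow_left Nat.lt_two_pow_self.le _
        _ = (2^k)^m := by rw [← pow_mul, ← pow_mul, mul_comm]
        _ ≤ _ := Nat.pow_le_pow_left h2k _
    have h3 : X.card ≤ (2 * U.card)^m * X'.card := hc.trans (Nat.mul_le_mul_right _ hmk)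
    calc (X.card : ℝ) ≤ (2 * (U.card : ℝ))^m * X'.card := by exact_mod_cast h3
      _ ≤ _ := by gcongr
  · by_contra hne
    refine hX' u v hu hv (mem_erase.2 ⟨sub_ne_zero.2 hne, mem_filter.2 ⟨mem_univ _, ?_⟩⟩)
    refine mem_sub.2 ⟨∑ i, (u i, f (u i)), fs_sum_mem _ _ _ fun i => mem_image_of_mem _ (hs (hu i)),
      ∑ i, (v i, f (v i)), fs_sum_mem _ _ _ fun i => mem_image_of_mem _ (hs (hv i)), ?_⟩
    ext1
    · simp [Prod.fst_sum, huv]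
    · simp [Prod.snd_sum]

/-- If `f̃(x) + g̃(y) + h̃(z) = 0` holds with probability at least `ε` over
uniform `(x,y,z)` with `x + y + z = 0`, then `f̃` is an order-`m` Freiman homomorphism on a
subset of density `ε^C / C`. -/
theorem freiman_structure (m : ℕ) (hm : 2 ≤ m) :
    ∃ C : ℝ, 0 < C ∧
      ∀ (A : Type) [Fintype A] [AddCommGroup A],
      ∀ (n : ℕ), 1 ≤ n → ∀ (ε : ℝ), 0 < ε → ε ≤ 1 →
      ∀ (ft gt ht : (Fin n → A) → Fin n → ZMod m),
        (ε ≤ ((Finset.univ.filter (fun w : (Fin n → A) × (Fin n → A) × (Fin n → A) =>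
            w.1 + w.2.1 + w.2.2 = 0 ∧ ft w.1 + gt w.2.1 + ht w.2.2 = 0)).card : ℝ)
          / ((Finset.univ.filter (fun w : (Fin n → A) × (Fin n → A) × (Fin n → A) =>
              w.1 + w.2.1 + w.2.2 = 0)).card : ℝ)) →
        ∃ A' : Finset (Fin n → A),
          ε ^ C * (Fintype.card A : ℝ) ^ n / C ≤ A'.card ∧
          ∀ (u v : Fin m → (Fin n → A)),
            (∀ i, u i ∈ A') → (∀ i, v i ∈ A') →
            ∑ i, u i = ∑ i, v i →
            ∑ i, ft (u i) = ∑ i, ft (v i) := by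
  classical
  let c1 : ℕ := 1 + 6 * (2 * m + 1) * m
  let c2 : ℝ := 4 * (2 * 4096 ^ (2 * m + 1)) ^ m
  have hc2 : 0 < c2 := by positivity
  refine ⟨c1 + c2, by positivity, ?_⟩
  intro A _ _ n hn ε hε hε1 ft gt ht hyp
  have e1 : (univ.filter (fun w : (Fin n → A) × (Fin n → A) × (Fin n → A) =>
      w.1 + w.2.1 + w.2.2 = 0)).card = Fintype.card (Fin n → A) ^ 2 := by
    rw [sq, ← Fintype.card_prod, ← card_univ]
    symm
    refine card_bij (fun p _ => (p.1, p.2, -p.1 - p.2)) ?_ ?_ ?_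
    · intro p _; simp
    · rintro ⟨a, b⟩ _ ⟨c, d⟩ _ hh
      simp only [Prod.mk.injEq] at hh ⊢
      exact ⟨hh.1, hh.2.1⟩
    · rintro ⟨a, b, c⟩ hh
      have : a + b + c = 0 := (mem_filter.1 hh).2
      refine ⟨(a, b), mem_univ _, ?_⟩
      simp only [Prod.mk.injEq, true_and]
      rw [eq_neg_of_add_eq_zero_right this]; abel
  have e2 : (univ.filter (fun w : (Fin n → A) × (Fin n → A) × (Fin n → A) =>
      w.1 + w.2.1 + w.2.2 = 0 ∧ ft w.1 + gt w.2.1 + ht w.2.2 = 0)).card ≤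
      (univ.filter (fun p : (Fin n → A) × (Fin n → A) =>
        ft p.1 + gt p.2 + ht (-p.1-p.2) = 0)).card := by
    refine card_le_card_of_injOn (fun w => (w.1, w.2.1)) ?_ ?_
    · rintro ⟨a, b, c⟩ hh
      obtain ⟨i, j⟩ := (mem_filter.1 (mem_coe.1 hh)).2
      change a + b + c = 0 at i
      have i' : c = -a - b := by rw [eq_neg_of_add_eq_zero_right i]; abel
      subst i'
      exact mem_coe.2 (mem_filter.2 ⟨mem_univ _, j⟩)
    · rintro ⟨a, b, c⟩ h1 ⟨a', b', c'⟩ h2 hh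
      have i := eq_neg_of_add_eq_zero_right (mem_filter.1 (mem_coe.1 h1)).2.1
      have j := eq_neg_of_add_eq_zero_right (mem_filter.1 (mem_coe.1 h2)).2.1
      simp only [Prod.mk.injEq] at hh i j ⊢
      obtain ⟨rfl, rfl⟩ := hh
      exact ⟨rfl, rfl, i.trans j.symm⟩
  have hG : (0:ℝ) < Fintype.card (Fin n → A) := by
    exact_mod_cast (Fintype.card_pos : 0 < Fintype.card (Fin n → A))
  have hyp2 : ε * (Fintype.card (Fin n → A) : ℝ)^2 ≤
      ((univ.filter (fun p : (Fin n → A) × (Fin n → A) =>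
        ft p.1 + gt p.2 + ht (-p.1-p.2) = 0)).card : ℝ) := by
    rw [e1, le_div_iff₀ (by positivity)] at hyp
    push_cast at hyp
    exact hyp.trans (by exact_mod_cast e2)
  have : NeZero m := ⟨by omega⟩
  obtain ⟨X, hX, hhom⟩ := fs_core m hm ft gt ht ε hε (fs_sep hm ft) (by convert hyp2)
  refine ⟨X, ?_, hhom⟩
  have hcard : (Fintype.card (Fin n → A) : ℝ) = (Fintype.card A : ℝ)^n := by
    simp
  rw [hcard] at hX hG
  set N : ℝ := (Fintype.card A : ℝ)^n
  have h1 : ε ^ ((c1 : ℝ) + c2) ≤ ε ^ c1 := by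
    rw [← Real.rpow_natCast]
    exact Real.rpow_le_rpow_of_exponent_ge hε hε1 (by linarith)
  have h2 : ε ^ c1 * N ≤ c2 * X.card := by
    have e : (2 * (4096 / ε^6)^(2*m+1))^m * ε^(6*(2*m+1)*m) = (2 * 4096 ^ (2 * m + 1)) ^ m := by
      rw [pow_mul, pow_mul, ← mul_pow, mul_assoc, ← mul_pow, div_mul_cancel₀ _ (by positivity)]
    calc ε ^ c1 * N = 4 * ε^(6*(2*m+1)*m) * (ε * N / 4) := by
          simp only [c1]; rw [pow_add]; ring
      _ ≤ 4 * ε^(6*(2*m+1)*m) * ((2 * (4096 / ε^6)^(2*m+1))^m * X.card) := by gcongr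
      _ = 4 * ((2 * (4096 / ε^6)^(2*m+1))^m * ε^(6*(2*m+1)*m)) * X.card := by ring
      _ = _ := by rw [e]
  rw [div_le_iff₀ (by positivity)]
  calc ε ^ ((c1 : ℝ) + c2) * N ≤ ε ^ c1 * N := by gcongr
    _ ≤ c2 * X.card := h2
    _ ≤ X.card * (c1 + c2) := by
      have : (0:ℝ) ≤ c1 * X.card := by positivity
      nlinarith
end
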